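/- Let f_i ∈ C^∞(S³) with mean zero (∫_{S³} f_i dμ_{S³} = 0), and let u_i be the biharmonic extension of f_i to 𝔹⁴ with zero Neumann boundary condition (Δ²u_i = 0 in 𝔹⁴, u_i = f_i and ∂u_i/∂r = 0 on S³). Assume that, as i → ∞, u_i ⇀ u weakly in H²(𝔹⁴), u_i → u a.e. in 𝔹⁴, and (Δu_i)² dx ⇀ (Δu)² dx + σ as measures, where σ is a bounded nonnegative Borel measure on 𝔹⁴. If K ⊆ S³ is a compact set with σ(𝒞(K)) < 1, then for any 1 ≤ p < 1/σ(𝒞(K)) one has sup_i ∫_K e^{12π² p f_i²} dμ_{S³} < ∞. -/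

import Mathlib

open MeasureTheory Metric Filter
open scoped ENNReal RealInnerProductSpace

noncomputable section

abbrev E (n : ℕ) : Type := EuclideanSpace ℝ (Fin n)

/-- The standard surface measure on the unit sphere `S^{n-1}`, as a Borel measure on `ℝⁿ`. -/
def sphMeasure (n : ℕ) : Measure (E n) :=
  Measure.map Subtype.val ((volume : Measure (E n)).toSphere)

/-- The cone `𝒞(Ω) = { rξ : 0 ≤ r ≤ 1, ξ ∈ Ω }` with vertex at the origin and base `Ω`. -/
def cone (n : ℕ) (Ω : Set (E n)) : Set (E n) :=
  {x | ∃ r : ℝ, 0 ≤ r ∧ r ≤ 1 ∧ ∃ ξ ∈ Ω, x = r • ξ}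

/-- The Euclidean Laplacian `Δu = Σ_i ∂²u/∂x_i²`. -/
def lap (n : ℕ) (u : E n → ℝ) (x : E n) : ℝ :=
  ∑ i : Fin n, fderiv ℝ (fun y => fderiv ℝ u y (EuclideanSpace.single i 1)) x
    (EuclideanSpace.single i 1)


instance : IsFiniteMeasure (sphMeasure 4) := by
  unfold sphMeasure; infer_instance

lemma polar_lintegral (G : E 4 → ℝ≥0∞) (hG : Measurable G) :
    ∫⁻ x, G x = ∫⁻ r in Set.Ioi (0:ℝ), ENNReal.ofReal (r^3) * ∫⁻ y, G (r • y) ∂(sphMeasure 4) := by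
  have hd : Module.finrank ℝ (E 4) = 4 := by simp
  have h1 : ∫⁻ x, G x = ∫⁻ x : ({(0 : E 4)}ᶜ : Set (E 4)), G x.1 ∂((volume : Measure (E 4)).comap (↑)) := by
    rw [lintegral_subtype_comap (measurableSet_singleton _).compl G,
        restrict_compl_singleton]
  have h2 : ∫⁻ x : ({(0 : E 4)}ᶜ : Set (E 4)), G x.1 ∂((volume : Measure (E 4)).comap (↑)) =
      ∫⁻ z, G (z.2.1 • z.1.1) ∂((volume : Measure (E 4)).toSphere.prod (.volumeIoiPow (Module.finrank ℝ (E 4) - 1))) := by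
    rw [← ((volume : Measure (E 4)).measurePreserving_homeomorphUnitSphereProd).lintegral_comp_emb
      (Homeomorph.measurableEmbedding _)]
    congr 1; ext x
    congr 1
    have := (homeomorphUnitSphereProd (E 4)).symm_apply_apply x
    conv_lhs => rw [← this]
    rw [homeomorphUnitSphereProd_symm_apply_coe]
  rw [h1, h2, lintegral_prod_symm _ (by fun_prop), hd]
  have h3 : ∀ r : ℝ, ∫⁻ y, G (r • y) ∂(sphMeasure 4) = ∫⁻ y : sphere (0 : E 4) 1, G (r • y.1) ∂((volume : Measure (E 4)).toSphere) := by
    intro r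
    rw [sphMeasure, lintegral_map (by fun_prop) (by fun_prop)]
  simp_rw [h3]
  have hm : Measurable fun r : ℝ => ∫⁻ y : sphere (0 : E 4) 1, G (r • y.1) ∂((volume : Measure (E 4)).toSphere) := by
    apply Measurable.lintegral_prod_left' (f := fun z : sphere (0 : E 4) 1 × ℝ => G (z.2 • z.1.1))
    fun_prop
  rw [Measure.volumeIoiPow, lintegral_withDensity_eq_lintegral_mul _ (by fun_prop) (by fun_prop)]
  rw [← lintegral_subtype_comap measurableSet_Ioi]
  rfl

lemma integral_sph (g : E 4 → ℝ) (r : ℝ) (hg : Measurable g) : ∫ y, g (r • y) ∂(sphMeasure 4) = ∫ y : sphere (0 : E 4) 1, g (r • y.1) ∂((volume : Measure (E 4)).toSphere) := by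
  rw [sphMeasure, integral_map (by fun_prop)]
  exact (Measurable.stronglyMeasurable (by fun_prop)).aestronglyMeasurable

lemma polar_integral (G : E 4 → ℝ) (hG : Measurable G) (hi : Integrable G) :
    ∫ x, G x = ∫ r in Set.Ioi (0:ℝ), r^3 * ∫ y, G (r • y) ∂(sphMeasure 4) := by
  have hd : Module.finrank ℝ (E 4) = 4 := by simp
  have h1 : ∫ x, G x = ∫ x : ({(0 : E 4)}ᶜ : Set (E 4)), G x.1 ∂((volume : Measure (E 4)).comap (↑)) := by
    rw [integral_subtype_comap (measurableSet_singleton _).compl G,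
        restrict_compl_singleton]
  have hc : (fun x : ({(0 : E 4)}ᶜ : Set (E 4)) => G x.1) = (fun z : sphere (0 : E 4) 1 × Set.Ioi (0:ℝ) => G (z.2.1 • z.1.1)) ∘ (homeomorphUnitSphereProd (E 4)) := by
    ext x
    have := (homeomorphUnitSphereProd (E 4)).symm_apply_apply x
    simp only [Function.comp]
    conv_lhs => rw [← this]
    rw [homeomorphUnitSphereProd_symm_apply_coe]
  have hi1 : Integrable (fun x : ({(0 : E 4)}ᶜ : Set (E 4)) => G x.1) ((volume : Measure (E 4)).comap (↑)) := by
    have := (integrableOn_iff_comap_subtypeVal (measurableSet_singleton (0 : E 4)).compl (f := G) (μ := volume)).1 hi.integrableOn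
    exact this
  have hi2 : Integrable (fun z : sphere (0 : E 4) 1 × Set.Ioi (0:ℝ) => G (z.2.1 • z.1.1)) ((volume : Measure (E 4)).toSphere.prod (.volumeIoiPow (Module.finrank ℝ (E 4) - 1))) := by
    rw [hc] at hi1
    exact (((volume : Measure (E 4)).measurePreserving_homeomorphUnitSphereProd).integrable_comp_emb (Homeomorph.measurableEmbedding _)).1 hi1
  have h2 : ∫ x : ({(0 : E 4)}ᶜ : Set (E 4)), G x.1 ∂((volume : Measure (E 4)).comap (↑)) =
      ∫ z, G (z.2.1 • z.1.1) ∂((volume : Measure (E 4)).toSphere.prod (.volumeIoiPow (Module.finrank ℝ (E 4) - 1))) := by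
    rw [hc]
    exact ((volume : Measure (E 4)).measurePreserving_homeomorphUnitSphereProd).integral_comp
      (Homeomorph.measurableEmbedding _) (fun z : sphere (0 : E 4) 1 × Set.Ioi (0:ℝ) => G (z.2.1 • z.1.1))
  rw [h1, h2, integral_prod_symm _ hi2, hd]
  simp_rw [integral_sph G _ hG]
  rw [Measure.volumeIoiPow, integral_withDensity_eq_integral_toReal_smul (by fun_prop) (by simp)]
  rw [← integral_subtype_comap measurableSet_Ioi]
  congr 1; ext r
  have : (0:ℝ) < r.1 := r.2
  rw [ENNReal.toReal_ofReal (by positivity)]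
  rfl

lemma sph_ae : ∀ᵐ y ∂(sphMeasure 4), ‖y‖ = 1 := by
  rw [sphMeasure, ae_map_iff (by fun_prop) (measurableSet_eq_fun (by fun_prop) (by fun_prop))]
  filter_upwards with y
  exact mem_sphere_zero_iff_norm.1 y.2

lemma vol_ball4 : (volume : Measure (E 4)).real (ball 0 1) = Real.pi ^ 2 / 2 := by
  rw [Measure.real, EuclideanSpace.volume_ball]
  simp
  have : Real.Gamma (4/2+1) = 2 := by
    rw [show (4/2+1 : ℝ) = ((2:ℕ):ℝ) + 1 by norm_num, Real.Gamma_nat_eq_factorial]; simp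
  rw [this]
  rw [show (4:ℕ) = 2*2 by norm_num, pow_mul, Real.sq_sqrt Real.pi_pos.le]
  rw [ENNReal.toReal_ofReal (by positivity)]

lemma sph_univ : (sphMeasure 4).real Set.univ = 2 * Real.pi^2 := by
  have h : (sphMeasure 4).real Set.univ = ((volume : Measure (E 4)).toSphere).real Set.univ := by
    rw [sphMeasure, map_measureReal_apply (by fun_prop) MeasurableSet.univ]; simp
  rw [h, Measure.toSphere_real_apply_univ, vol_ball4]
  simp; ring

abbrev SS : ℝ → ℝ := Real.smoothTransition

lemma SS_cd : ContDiff ℝ 2 SS := Real.smoothTransition.contDiff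

lemma SS_deriv_nonneg (s : ℝ) : 0 ≤ deriv SS s := by
  apply Monotone.deriv_nonneg
  exact Real.smoothTransition.monotone

lemma SS_deriv_zero_of_nonpos {s : ℝ} (h : s ≤ 0) : deriv SS s = 0 := by
  apply IsLocalMin.deriv_eq_zero
  filter_upwards with x
  rw [SS, Real.smoothTransition.zero_of_nonpos h]
  exact Real.smoothTransition.nonneg x

lemma SS_deriv_zero_of_one_le {s : ℝ} (h : 1 ≤ s) : deriv SS s = 0 := by
  apply IsLocalMax.deriv_eq_zero
  filter_upwards with x
  rw [SS, Real.smoothTransition.one_of_one_le h]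
  exact Real.smoothTransition.le_one x

lemma SS_deriv_cont : Continuous (deriv SS) := SS_cd.continuous_deriv (by norm_num)

lemma peak_lim (g : ℝ → ℝ) (hg : Continuous g) :
    Tendsto (fun n : ℕ => ∫ r in Set.Ioo (0:ℝ) 1, (2 * n * r * deriv SS (n * (1 - r^2))) • g r) atTop (nhds (g 1)) := by
  have hdS := SS_deriv_cont
  apply tendsto_setIntegral_peak_smul_of_integrableOn_of_tendsto (t := Set.Ioo (0:ℝ) 1) (x₀ := 1) (s := Set.Ioo (0:ℝ) 1) (μ := volume)
    (φ := fun (n : ℕ) (r : ℝ) => (2 * n * r * deriv SS (n * (1 - r^2)))) measurableSet_Ioo measurableSet_Ioo subset_rfl self_mem_nhdsWithin (by simp)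
  · filter_upwards with n r hr
    have := SS_deriv_nonneg (n * (1 - r^2))
    have := hr.1.le
    positivity
  · intro u hu h1
    rw [Metric.isOpen_iff] at hu
    obtain ⟨ε, hε, hb⟩ := hu 1 h1
    rw [Metric.tendstoUniformlyOn_iff]
    intro η hη
    obtain ⟨N, hN⟩ := exists_nat_gt (1/ε)
    filter_upwards [eventually_ge_atTop N] with n hn r hr
    have hr1 : r ≤ 1 - ε := by
      by_contra hc
      apply hr.2
      apply hb
      rw [Metric.mem_ball, Real.dist_eq, abs_lt]
      constructor <;> linarith [hr.1.2]
    have h3 : (1:ℝ) ≤ n * (1 - r^2) := by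
      have : (1/ε) < n := lt_of_lt_of_le hN (by exact_mod_cast hn)
      have h4 : 1 < n * ε := by rwa [div_lt_iff₀ hε] at this
      have : ε ≤ 1 - r^2 := by nlinarith [hr.1.1, hr.1.2]
      have hn0 : (0:ℝ) ≤ n := by positivity
      nlinarith
    rw [SS_deriv_zero_of_one_le h3]
    simpa using hη
  · apply tendsto_const_nhds.congr'
    filter_upwards [eventually_ge_atTop 1] with n hn
    rw [← integral_Ioc_eq_integral_Ioo, ← intervalIntegral.integral_of_le zero_le_one]
    have : ∀ r ∈ Set.uIcc (0:ℝ) 1, HasDerivAt (fun r => - SS (n * (1 - r^2))) (2 * n * r * deriv SS (n * (1 - r^2))) r := by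
      intro r _
      have h1 : HasDerivAt SS (deriv SS (n * (1 - r^2))) (n * (1 - r^2)) :=
        (SS_cd.differentiable (by norm_num)).differentiableAt.hasDerivAt
      have h2 : HasDerivAt (fun r : ℝ => (n:ℝ) * (1 - r^2)) (n * (0 - 2 * r)) r := by
        exact (((hasDerivAt_pow 2 r).const_sub 1).const_mul (n:ℝ)).congr_deriv (by norm_num)
      have h3 : HasDerivAt (fun r => - SS (n * (1 - r^2))) (-(deriv SS (n * (1 - r^2)) * (n * (0 - 2 * r)))) r :=
        (HasDerivAt.scomp r h1 h2 |>.neg).congr_deriv (by simp; ring)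
      exact h3.congr_deriv (by ring)
    rw [intervalIntegral.integral_eq_sub_of_hasDerivAt this]
    · have h1 : (1:ℝ) ≤ n := by exact_mod_cast hn
      simp [SS, Real.smoothTransition.one_of_one_le h1, Real.smoothTransition.zero]
    · apply Continuous.intervalIntegrable
      fun_prop
  · filter_upwards with n
    exact (by fun_prop : Continuous (fun r : ℝ => (2 * n * r * deriv SS (n * (1 - r^2))))).aestronglyMeasurable
  · exact (hg.integrableOn_Icc).mono_set Set.Ioo_subset_Icc_self
  · exact hg.continuousAt.continuousWithinAt

def cut (n : ℕ) (x : E 4) : ℝ := SS (n * (1 - ‖x‖^2))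

lemma cut_cd (n : ℕ) : ContDiff ℝ 2 (cut n) := by
  unfold cut
  exact SS_cd.comp (contDiff_const.mul (contDiff_const.sub (contDiff_norm_sq ℝ)))

lemma cut_fderiv (n : ℕ) (x v : E 4) : fderiv ℝ (cut n) x v = - (2 * n * deriv SS (n * (1 - ‖x‖^2)) * ⟪x, v⟫) := by
  have h1 : HasDerivAt SS (deriv SS (n * (1 - ‖x‖^2))) (n * (1 - ‖x‖^2)) :=
        (SS_cd.differentiable (by norm_num)).differentiableAt.hasDerivAt
  have h2 : HasFDerivAt (fun x : E 4 => (n:ℝ) * (1 - ‖x‖^2)) ((n:ℝ) • (- ((2:ℕ) • (innerSL ℝ x : E 4 →L[ℝ] ℝ)) : E 4 →L[ℝ] ℝ)) x :=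
    (((hasStrictFDerivAt_norm_sq x).hasFDerivAt.const_sub 1)).const_mul (n:ℝ)
  have := (h1.comp_hasFDerivAt x h2).fderiv
  have h3 : cut n = SS ∘ (fun x : E 4 => (n:ℝ) * (1 - ‖x‖^2)) := rfl
  rw [h3, this]
  simp
  ring

lemma cut_zero (n : ℕ) (x : E 4) (hx : 1 ≤ ‖x‖) : cut n x = 0 := by
  apply Real.smoothTransition.zero_of_nonpos
  apply mul_nonpos_of_nonneg_of_nonpos (by positivity)
  nlinarith

lemma cut_le (n : ℕ) (x : E 4) : |cut n x| ≤ 1 := by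
  unfold cut SS
  rw [abs_of_nonneg (Real.smoothTransition.nonneg _)]
  exact Real.smoothTransition.le_one _

lemma cut_cs (n : ℕ) : HasCompactSupport (cut n) := by
  apply HasCompactSupport.of_support_subset_isCompact (isCompact_closedBall (0 : E 4) 1)
  intro x hx
  by_contra h
  apply hx
  apply cut_zero
  simp at h
  exact h.le

lemma cont_int {g : E 4 → ℝ} (hg : Continuous g) (hs : HasCompactSupport g) : Integrable g :=
  hg.integrable_of_hasCompactSupport hs

lemma sph_param_cont (q : E 4 → ℝ) (hq : Continuous q) :
    Continuous (fun r : ℝ => ∫ y, q (r • y) ∂(sphMeasure 4)) := by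
  simp_rw [integral_sph q _ hq.measurable]
  have := continuous_parametric_integral_of_continuous (μ := (volume : Measure (E 4)).toSphere) (f := fun (r : ℝ) (y : sphere (0 : E 4) 1) => q (r • y.1)) (by fun_prop) (isCompact_univ)
  simpa using this

lemma ball_int {g : E 4 → ℝ} (hg : Continuous g) : IntegrableOn g (ball 0 1) :=
  (hg.continuousOn.integrableOn_compact (isCompact_closedBall (0 : E 4) 1)).mono_set ball_subset_closedBall

lemma inner_single (x : E 4) (i : Fin 4) : ⟪x, EuclideanSpace.single i (1:ℝ)⟫ = x i := by
  simp [EuclideanSpace.inner_single_right]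

lemma div_thm (F : Fin 4 → E 4 → ℝ) (hF : ∀ i, ContDiff ℝ 1 (F i)) :
    ∫ x in ball (0 : E 4) 1, ∑ i, fderiv ℝ (F i) x (EuclideanSpace.single i 1)
      = ∫ y, ∑ i, F i y * y i ∂(sphMeasure 4) := by
  have hdF : ∀ i, Continuous fun x => fderiv ℝ (F i) x (EuclideanSpace.single i 1) := fun i =>
    ((hF i).continuous_fderiv (by norm_num)).clm_apply continuous_const
  have hFc : ∀ i, Continuous (F i) := fun i => (hF i).continuous
  have hdc := fun n => cut_cd n
  have hcc : ∀ n, Continuous (cut n) := fun n => (cut_cd n).continuous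
  have hdcc : ∀ n (i : Fin 4), Continuous fun x => fderiv ℝ (cut n) x (EuclideanSpace.single i 1) := fun n i =>
    ((cut_cd n).continuous_fderiv (by norm_num)).clm_apply continuous_const
  have hdcs : ∀ n (i : Fin 4), HasCompactSupport fun x => fderiv ℝ (cut n) x (EuclideanSpace.single i 1) := fun n i =>
    (cut_cs n).fderiv_apply (𝕜 := ℝ) _
  have ibp : ∀ n i, ∫ x, cut n x * fderiv ℝ (F i) x (EuclideanSpace.single i 1)
      = - ∫ x, fderiv ℝ (cut n) x (EuclideanSpace.single i 1) * F i x := by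
    intro n i
    apply integral_mul_fderiv_eq_neg_fderiv_mul_of_integrable
    · exact cont_int ((hdcc n i).mul (hFc i)) ((hdcs n i).mul_right)
    · exact cont_int ((hcc n).mul (hdF i)) ((cut_cs n).mul_right)
    · exact cont_int ((hcc n).mul (hFc i)) ((cut_cs n).mul_right)
    · intro x _; exact ((hdc n).differentiable (by norm_num)).differentiableAt
    · intro x _; exact ((hF i).differentiable (by norm_num)).differentiableAt
  have hq : Continuous fun x : E 4 => ∑ i, F i x * x i := by fun_prop
  have hdv : Continuous fun x : E 4 => ∑ i, fderiv ℝ (F i) x (EuclideanSpace.single i 1) := by fun_prop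
  have key : ∀ n : ℕ, ∫ x, cut n x * ∑ i, fderiv ℝ (F i) x (EuclideanSpace.single i 1)
      = ∫ r in Set.Ioo (0:ℝ) 1, (2 * n * r * deriv SS (n * (1 - r^2))) • (r^2 * ∫ y, (∑ i, F i (r • y) * (r • y) i) ∂(sphMeasure 4)) := by
    intro n
    have e1 : ∫ x, cut n x * ∑ i, fderiv ℝ (F i) x (EuclideanSpace.single i 1)
        = ∫ x : E 4, (2 * n * deriv SS (n * (1 - ‖x‖^2))) * ∑ i, F i x * x i := by
      simp_rw [Finset.mul_sum]
      rw [integral_finsetSum, integral_finsetSum]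
      · apply Finset.sum_congr rfl
        intro i _
        rw [ibp, ← integral_neg]
        congr 1; ext x
        rw [cut_fderiv, inner_single]; ring
      · intro i _
        have : (fun x : E 4 => (2 * n * deriv SS (n * (1 - ‖x‖^2))) * (F i x * x i)) = fun x => -(fderiv ℝ (cut n) x (EuclideanSpace.single i 1) * F i x) := by
          ext x; rw [cut_fderiv, inner_single]; ring
        rw [this]
        exact (cont_int ((hdcc n i).mul (hFc i)) ((hdcs n i).mul_right)).neg
      · intro i _
        exact cont_int ((hcc n).mul (hdF i)) ((cut_cs n).mul_right)
    have hdS := SS_deriv_cont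
    rw [e1, polar_integral]
    · have e2 : ∀ r ∈ Set.Ioi (0:ℝ), (r^3 * ∫ y, (2 * n * deriv SS (n * (1 - ‖r • y‖^2))) * ∑ i, F i (r • y) * (r • y) i ∂(sphMeasure 4))
          = (2 * n * r * deriv SS (n * (1 - r^2))) • (r^2 * ∫ y, (∑ i, F i (r • y) * (r • y) i) ∂(sphMeasure 4)) := by
        intro r hr
        have : ∫ y, (2 * n * deriv SS (n * (1 - ‖r • y‖^2))) * ∑ i, F i (r • y) * (r • y) i ∂(sphMeasure 4) = 
          (2 * n * deriv SS (n * (1 - r^2))) * ∫ y, ∑ i, F i (r • y) * (r • y) i ∂(sphMeasure 4) := by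
          rw [← integral_const_mul]
          apply integral_congr_ae
          filter_upwards [sph_ae] with y hy
          rw [norm_smul, hy, mul_one, Real.norm_eq_abs, sq_abs]
        rw [this, smul_eq_mul]; ring
      rw [setIntegral_congr_fun measurableSet_Ioi e2]
      apply setIntegral_eq_of_subset_of_forall_sdiff_eq_zero measurableSet_Ioi Set.Ioo_subset_Ioi_self
      intro r hr
      have hr1 : 1 ≤ r := by
        by_contra h
        exact hr.2 ⟨hr.1, not_le.1 h⟩
      rw [SS_deriv_zero_of_nonpos]
      · simp
      · apply mul_nonpos_of_nonneg_of_nonpos (by positivity)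
        nlinarith
    · fun_prop
    · apply cont_int (by fun_prop)
      apply HasCompactSupport.of_support_subset_isCompact (isCompact_closedBall (0 : E 4) 1)
      intro x hx
      by_contra h
      apply hx
      simp only [mem_closedBall, dist_zero_right, not_le] at h
      simp only []
      rw [SS_deriv_zero_of_nonpos]
      · simp
      · apply mul_nonpos_of_nonneg_of_nonpos (by positivity)
        nlinarith
  have lim1 := peak_lim (fun r => r^2 * ∫ y, (∑ i, F i (r • y) * (r • y) i) ∂(sphMeasure 4))
    ((continuous_pow 2).mul (sph_param_cont _ hq))
  simp_rw [← key] at lim1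
  have lim2 : Tendsto (fun n : ℕ => ∫ x, cut n x * ∑ i, fderiv ℝ (F i) x (EuclideanSpace.single i 1)) atTop
      (nhds (∫ x in ball (0 : E 4) 1, ∑ i, fderiv ℝ (F i) x (EuclideanSpace.single i 1))) := by
    rw [← integral_indicator measurableSet_ball]
    apply tendsto_integral_of_dominated_convergence ((ball (0 : E 4) 1).indicator fun x => |∑ i, fderiv ℝ (F i) x (EuclideanSpace.single i 1)|)
    · intro n
      exact ((hcc n).mul hdv).aestronglyMeasurable
    · rw [integrable_indicator_iff measurableSet_ball]
      exact (ball_int hdv).abs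
    · intro n
      filter_upwards with x
      by_cases hx : x ∈ ball (0 : E 4) 1
      · rw [Set.indicator_of_mem hx, norm_mul, Real.norm_eq_abs, Real.norm_eq_abs]
        exact mul_le_of_le_one_left (abs_nonneg _) (cut_le n x)
      · rw [Set.indicator_of_notMem hx, cut_zero n x (by simpa using hx)]; simp
    · filter_upwards with x
      by_cases hx : x ∈ ball (0 : E 4) 1
      · rw [Set.indicator_of_mem hx]
        apply tendsto_const_nhds.congr'
        have hx1 : ‖x‖ < 1 := by simpa using hx
        have h2 : 0 < 1 - ‖x‖^2 := by nlinarith [norm_nonneg x]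
        obtain ⟨N, hN⟩ := exists_nat_gt (1/(1 - ‖x‖^2))
        filter_upwards [eventually_ge_atTop N] with n hn
        have : (1/(1 - ‖x‖^2)) < n := lt_of_lt_of_le hN (by exact_mod_cast hn)
        rw [div_lt_iff₀ h2] at this
        rw [cut, SS, Real.smoothTransition.one_of_one_le this.le, one_mul]
      · rw [Set.indicator_of_notMem hx]
        apply tendsto_const_nhds.congr
        intro n
        rw [cut_zero n x (by simpa using hx), zero_mul]
  have := tendsto_nhds_unique lim2 lim1
  rw [this]
  simp

lemma sum_single (L : E 4 →L[ℝ] ℝ) (y : E 4) : ∑ i, L (EuclideanSpace.single i 1) * y i = L y := by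
  have h : y = ∑ i, y i • (EuclideanSpace.single i (1:ℝ) : E 4) := by
    ext j
    simp [Finset.sum_apply, Pi.single_apply]
  conv_rhs => rw [h]
  rw [map_sum]
  apply Finset.sum_congr rfl
  intro i _
  rw [map_smul, smul_eq_mul, mul_comm]

lemma green (h u : E 4 → ℝ) (hh : ContDiff ℝ 2 h) (hu : ContDiff ℝ 2 u) :
    ∫ x in ball (0 : E 4) 1, (h x * lap 4 u x - u x * lap 4 h x)
      = ∫ y, (h y * fderiv ℝ u y y - u y * fderiv ℝ h y y) ∂(sphMeasure 4) := by
  have d1 : ∀ {g : E 4 → ℝ}, ContDiff ℝ 2 g → ∀ v, ContDiff ℝ 1 (fun y => fderiv ℝ g y v) := by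
    intro g hg v
    exact (hg.fderiv_right (m := 1) (by norm_num)).clm_apply contDiff_const
  have hh1 : ContDiff ℝ 1 h := hh.of_le (by norm_num)
  have hu1 : ContDiff ℝ 1 u := hu.of_le (by norm_num)
  have := div_thm (fun i y => h y * fderiv ℝ u y (EuclideanSpace.single i 1) - u y * fderiv ℝ h y (EuclideanSpace.single i 1))
    (fun i => (hh1.mul (d1 hu _)).sub (hu1.mul (d1 hh _)))
  convert this using 1
  · congr 1; ext x
    rw [lap, lap, Finset.mul_sum, Finset.mul_sum, ← Finset.sum_sub_distrib]
    apply Finset.sum_congr rfl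
    intro i _
    have a1 := (hh1.differentiable (by norm_num) x)
    have a2 := (hu1.differentiable (by norm_num) x)
    have a3 := ((d1 hh (EuclideanSpace.single i 1)).differentiable (by norm_num) x)
    have a4 := ((d1 hu (EuclideanSpace.single i 1)).differentiable (by norm_num) x)
    have := ((a1.hasFDerivAt.mul a4.hasFDerivAt).sub (a2.hasFDerivAt.mul a3.hasFDerivAt)).fderiv
    erw [this]
    simp
    ring
  · congr 1; ext y
    rw [← sum_single (fderiv ℝ u y) y, ← sum_single (fderiv ℝ h y) y, Finset.mul_sum, Finset.mul_sum, ← Finset.sum_sub_distrib]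
    apply Finset.sum_congr rfl
    intro i _
    ring

/-- the kernel -/
def Hk (t : ℝ) (ξ y : E 4) : ℝ := (‖t • y - ξ‖^2)⁻¹

def Hs (t : ℝ) (ξ y : E 4) : ℝ := (‖t • y - ξ‖^2 + SS (‖y‖^2 - 1 - (1 - t^2)))⁻¹

lemma tyx_pos {t : ℝ} {ξ y : E 4} (hξ : ‖ξ‖ = 1) (ht0 : 0 ≤ t) (h : t * ‖y‖ < 1) : 0 < ‖t • y - ξ‖ := by
  have : ‖ξ‖ - ‖t • y‖ ≤ ‖t • y - ξ‖ := by rw [norm_sub_rev]; exact norm_sub_norm_le _ _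
  rw [norm_smul, hξ, Real.norm_eq_abs, abs_of_nonneg ht0] at this
  linarith

lemma Hs_cd {t : ℝ} {ξ : E 4} (hξ : ‖ξ‖ = 1) (ht0 : 0 ≤ t) (ht1 : t < 1) : ContDiff ℝ 2 (Hs t ξ) := by
  unfold Hs
  apply ContDiff.inv
  · apply ContDiff.add
    · exact (contDiff_norm_sq ℝ).comp (by fun_prop : ContDiff ℝ 2 fun y : E 4 => t • y - ξ)
    · exact SS_cd.comp (((contDiff_norm_sq ℝ).sub contDiff_const).sub contDiff_const)
  · intro y
    have h1 : 0 ≤ SS (‖y‖^2 - 1 - (1 - t^2)) := Real.smoothTransition.nonneg _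
    by_cases hc : t * ‖y‖ < 1
    · have := tyx_pos hξ ht0 hc
      positivity
    · have : 0 < SS (‖y‖^2 - 1 - (1 - t^2)) := by
        apply Real.smoothTransition.pos_of_pos
        have h2 : 1 ≤ t^2 * ‖y‖^2 := by nlinarith
        have h3 : 0 < 1 - t^2 := by nlinarith
        by_contra hn
        have : ‖y‖^2 ≤ 2 - t^2 := by linarith
        nlinarith [sq_nonneg t]
      positivity

lemma Hs_eq {t : ℝ} {ξ y : E 4} (h : ‖y‖^2 ≤ 2 - t^2) : Hs t ξ y = Hk t ξ y := by
  unfold Hs Hk SS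
  rw [Real.smoothTransition.zero_of_nonpos (by linarith), add_zero]

lemma Hs_ev {t : ℝ} {ξ y : E 4} (ht0 : 0 ≤ t) (ht1 : t < 1) (hy : ‖y‖ ≤ 1) : Hs t ξ =ᶠ[nhds y] Hk t ξ := by
  have : {z : E 4 | ‖z‖^2 < 2 - t^2} ∈ nhds y := by
    apply IsOpen.mem_nhds
    · exact isOpen_lt (by fun_prop) (by fun_prop)
    · simp only [Set.mem_ofPred_eq]; nlinarith [norm_nonneg y]
  filter_upwards [this] with z hz
  exact Hs_eq (le_of_lt hz)

lemma Hk_hasF {t : ℝ} {ξ y : E 4} (hp : 0 < ‖t • y - ξ‖) :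
    HasFDerivAt (Hk t ξ) ((-(2 * t) * ((‖t • y - ξ‖^2)⁻¹)^2) • (innerSL ℝ (t • y - ξ))) y := by
  have h0 : HasFDerivAt (fun y : E 4 => t • y - ξ) (t • ContinuousLinearMap.id ℝ (E 4)) y :=
    ((hasFDerivAt_id y).const_smul t).sub_const ξ
  have h1 := h0.norm_sq
  have h2 := (hasDerivAt_inv (x := ‖t • y - ξ‖^2) (by positivity)).comp_hasFDerivAt y h1
  refine HasFDerivAt.congr_fderiv h2 ?_
  ext v
  simp
  field_simp

lemma Hk_fd {t : ℝ} {ξ y : E 4} (hp : 0 < ‖t • y - ξ‖) (v : E 4) :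
    fderiv ℝ (Hk t ξ) y v = -(2 * t) * (Hk t ξ y)^2 * ⟪t • y - ξ, v⟫ := by
  rw [(Hk_hasF hp).fderiv]; rfl

lemma Hk_lap {t : ℝ} {ξ y : E 4} (hp : 0 < ‖t • y - ξ‖) : lap 4 (Hk t ξ) y = 0 := by
  have hopen : {z : E 4 | 0 < ‖t • z - ξ‖} ∈ nhds y := by
    exact (isOpen_lt (by fun_prop) (by fun_prop) : IsOpen {z : E 4 | 0 < ‖t • z - ξ‖}).mem_nhds hp
  have key : ∀ i : Fin 4, fderiv ℝ (fun z => fderiv ℝ (Hk t ξ) z (EuclideanSpace.single i 1)) y (EuclideanSpace.single i 1)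
      = -2 * t^2 * (Hk t ξ y)^2 + 8 * t^2 * (Hk t ξ y)^3 * ((t • y - ξ) i)^2 := by
    intro i
    have e : (fun z => fderiv ℝ (Hk t ξ) z (EuclideanSpace.single i 1)) =ᶠ[nhds y]
        fun z => -(2*t) * ((Hk t ξ z)^2 * ⟪t • z - ξ, EuclideanSpace.single i (1:ℝ)⟫) := by
      filter_upwards [hopen] with z hz
      rw [Hk_fd hz]
      ring
    rw [e.fderiv_eq]
    have h0 : HasFDerivAt (fun y : E 4 => t • y - ξ) (t • ContinuousLinearMap.id ℝ (E 4)) y :=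
      ((hasFDerivAt_id y).const_smul t).sub_const ξ
    have h1 := h0.inner ℝ (hasFDerivAt_const (EuclideanSpace.single i (1:ℝ) : E 4) y)
    have h2 := ((Hk_hasF hp).pow 2).mul h1
    have h3 := (h2.const_mul (-(2*t))).fderiv
    erw [h3]
    simp [inner_single, Hk]
    ring
  rw [lap, Finset.sum_congr rfl (fun i _ => key i), Finset.sum_add_distrib, ← Finset.mul_sum, ← Finset.mul_sum]
  have hn : ∑ i, ((t • y - ξ) i)^2 = ‖t • y - ξ‖^2 := by
    rw [EuclideanSpace.norm_sq_eq]; simp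
  rw [hn]
  simp [Hk]
  field_simp
  norm_num

lemma green_t {t : ℝ} {ξ : E 4} (hξ : ‖ξ‖ = 1) (ht0 : 0 ≤ t) (ht1 : t < 1) (u : E 4 → ℝ) (hu : ContDiff ℝ 2 u)
    (hneu : ∀ x ∈ Metric.sphere (0 : E 4) 1, fderiv ℝ u x x = 0) :
    ∫ x in ball (0 : E 4) 1, Hk t ξ x * lap 4 u x
      = t * ∫ y, u y * (2 * ⟪t • y - ξ, y⟫ * (Hk t ξ y)^2) ∂(sphMeasure 4) := by
  have g := green (Hs t ξ) u (Hs_cd hξ ht0 ht1) hu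
  have hpos : ∀ y : E 4, ‖y‖ ≤ 1 → 0 < ‖t • y - ξ‖ := by
    intro y hy
    apply tyx_pos hξ ht0
    nlinarith [norm_nonneg y]
  have e1 : ∫ x in ball (0 : E 4) 1, (Hs t ξ x * lap 4 u x - u x * lap 4 (Hs t ξ) x) = ∫ x in ball (0 : E 4) 1, Hk t ξ x * lap 4 u x := by
    apply setIntegral_congr_fun measurableSet_ball
    intro x hx
    have hx1 : ‖x‖ ≤ 1 := by
      have : ‖x‖ < 1 := by simpa using hx
      exact this.le
    have ev := Hs_ev (ξ := ξ) ht0 ht1 hx1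
    have : lap 4 (Hs t ξ) x = lap 4 (Hk t ξ) x := by
      unfold lap
      apply Finset.sum_congr rfl
      intro i _
      have : (fun z => fderiv ℝ (Hs t ξ) z (EuclideanSpace.single i 1)) =ᶠ[nhds x] (fun z => fderiv ℝ (Hk t ξ) z (EuclideanSpace.single i 1)) := by
        filter_upwards [ev.fderiv (𝕜 := ℝ)] with z hz
        rw [hz]
      rw [this.fderiv_eq]
    simp only []
    rw [this, Hk_lap (hpos x hx1), ev.eq_of_nhds]; ring
  rw [← e1, g, ← integral_const_mul]
  apply integral_congr_ae
  filter_upwards [sph_ae] with y hy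
  rw [hneu y (by simpa using hy), (Hs_ev ht0 ht1 hy.le).fderiv_eq, Hk_fd (hpos y hy.le)]
  ring

lemma CS {α : Type*} [MeasurableSpace α] (μ : Measure α) (f g : α → ℝ) (hf : ∀ᵐ x ∂μ, 0 ≤ f x) (hg : ∀ᵐ x ∂μ, 0 ≤ g x)
    (mf : AEStronglyMeasurable f μ) (mg : AEStronglyMeasurable g μ)
    (h1 : Integrable (fun x => f x ^ 2) μ) (h2 : Integrable (fun x => g x ^ 2) μ) :
    ∫ x, f x * g x ∂μ ≤ √(∫ x, f x ^ 2 ∂μ) * √(∫ x, g x ^ 2 ∂μ) := by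
  have := integral_mul_le_Lp_mul_Lq_of_nonneg (p := 2) (q := 2) (μ := μ) (f := f) (g := g) ⟨by norm_num, by norm_num, by norm_num⟩ hf hg
    (by simpa using (memLp_two_iff_integrable_sq mf).2 h1) (by simpa using (memLp_two_iff_integrable_sq mg).2 h2)
  simpa [Real.sqrt_eq_rpow] using this

lemma rad_formula (f : ℝ → ℝ) : ∫ z : E 4, f ‖z‖ = 2 * Real.pi^2 * ∫ r in Set.Ioi (0:ℝ), r^3 * f r := by
  rw [integral_fun_norm_addHaar, vol_ball4]
  simp
  ring

lemma rad_int0 {a R : ℝ} (ha : a < 4) (hR : 0 < R) :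
    IntegrableOn (fun z : E 4 => ‖z‖^(-a)) (ball 0 R) ∧ ∫ z in ball (0 : E 4) R, ‖z‖^(-a) = 2 * Real.pi^2 * (R^(4-a)/(4-a)) := by
  have e : ∀ r ∈ Set.Ioo 0 R, r^(3 - a) = r^3 * r^(-a) := by
    intro r hr
    rw [show (3 - a) = ((3:ℕ):ℝ) + (-a) by push_cast; ring, Real.rpow_add hr.1, Real.rpow_natCast]
  constructor
  · have := integrableOn_fun_norm_addHaar (E := E 4) (F := ℝ) (μ := volume) (f := fun r : ℝ => r^(-a)) (r := R)
    rw [this]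
    have h2 : IntegrableOn (fun r : ℝ => r^(3 - a)) (Set.Ioo 0 R) := by
      rw [intervalIntegral.integrableOn_Ioo_rpow_iff hR]; linarith
    apply h2.congr_fun _ measurableSet_Ioo
    intro r hr
    simp [e r hr]
  · have : ∫ z in ball (0 : E 4) R, ‖z‖^(-a) = ∫ z : E 4, (Set.Iio R).indicator (fun r => r^(-a)) ‖z‖ := by
      rw [← integral_indicator measurableSet_ball]
      congr 1; ext z
      by_cases h : ‖z‖ < R
      · rw [Set.indicator_of_mem (by simpa using h), Set.indicator_of_mem (by simpa using h)]
      · rw [Set.indicator_of_notMem (by simpa using h), Set.indicator_of_notMem (by simpa using h)]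
    rw [this, rad_formula]
    congr 1
    have : ∀ r ∈ Set.Ioi (0:ℝ), r^3 * (Set.Iio R).indicator (fun r => r^(-a)) r = (Set.Ioo 0 R).indicator (fun r => r^(3-a)) r := by
      intro r hr
      by_cases h : r < R
      · rw [Set.indicator_of_mem (by simpa using h), Set.indicator_of_mem (show r ∈ Set.Ioo 0 R from ⟨hr, h⟩), e r ⟨hr, h⟩]
      · rw [Set.indicator_of_notMem (by simpa using h), Set.indicator_of_notMem (fun h' => h h'.2), mul_zero]
    rw [setIntegral_congr_fun measurableSet_Ioi this, setIntegral_indicator measurableSet_Ioo]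
    rw [Set.inter_eq_right.2 Set.Ioo_subset_Ioi_self, ← integral_Ioc_eq_integral_Ioo, ← intervalIntegral.integral_of_le hR.le]
    rw [integral_rpow (Or.inl (by linarith))]
    rw [Real.zero_rpow (by linarith)]
    rw [show 3 - a + 1 = 4 - a by ring]; simp

lemma rad_int (ξ : E 4) {a R : ℝ} (ha : a < 4) (hR : 0 < R) :
    IntegrableOn (fun y : E 4 => ‖y - ξ‖^(-a)) (ball ξ R) ∧ ∫ y in ball ξ R, ‖y - ξ‖^(-a) = 2 * Real.pi^2 * (R^(4-a)/(4-a)) := by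
  have h := rad_int0 ha hR
  have mp := measurePreserving_sub_right (volume : Measure (E 4)) ξ
  have me : MeasurableEmbedding (fun y : E 4 => y - ξ) := (Homeomorph.subRight ξ).measurableEmbedding
  have hb : (fun y : E 4 => y - ξ) ⁻¹' (ball 0 R) = ball ξ R := by
    ext y; simp [dist_eq_norm]
  constructor
  · have := (mp.integrableOn_comp_preimage me (f := fun z : E 4 => ‖z‖^(-a)) (s := ball 0 R)).2 h.1
    rw [hb] at this
    exact this
  · have := mp.setIntegral_preimage_emb me (fun z : E 4 => ‖z‖^(-a)) (ball 0 R)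
    rw [hb] at this
    rw [← h.2, ← this]

lemma annulus {ρ δ : ℝ} (hρ : 0 < ρ) (hδ : ρ ≤ δ) {ξ : E 4} (hξ : ‖ξ‖ = 1) :
    IntegrableOn (fun y : E 4 => ‖y - ξ‖^(-4:ℝ)) (ball 0 1 ∩ (ball ξ δ \ ball ξ ρ)) ∧
    ∫ y in ball 0 1 ∩ (ball ξ δ \ ball ξ ρ), ‖y - ξ‖^(-4:ℝ) ≤ Real.pi^2 * Real.log (δ/ρ) := by
  have hms : MeasurableSet (ball (0 : E 4) 1 ∩ (ball ξ δ \ ball ξ ρ)) := measurableSet_ball.inter (measurableSet_ball.diff measurableSet_ball)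
  set S := (ball (0 : E 4) 1 ∩ (ball ξ δ \ ball ξ ρ)) with hS
  have hIntg : ∀ T : Set (E 4), MeasurableSet T → T ⊆ ball ξ δ \ ball ξ ρ → IntegrableOn (fun y : E 4 => ‖y - ξ‖^(-4:ℝ)) T := by
    intro T hT hTs
    refine Measure.integrableOn_of_bounded (M := ρ^(-4:ℝ)) ?_ ?_ ?_
    · exact (lt_of_le_of_lt (measure_mono (hTs.trans Set.sdiff_subset)) measure_ball_lt_top).ne
    · exact (Measurable.aestronglyMeasurable (by fun_prop))
    · filter_upwards [ae_restrict_mem hT] with y hy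
      have := (hTs hy).2
      simp only [mem_ball, dist_eq_norm, not_lt] at this
      rw [Real.norm_of_nonneg (by positivity)]
      exact Real.rpow_le_rpow_of_nonpos hρ this (by norm_num)
  refine ⟨hIntg S hms Set.inter_subset_right, ?_⟩
  set W := ball (0 : E 4) δ \ ball (0 : E 4) ρ
  have hW : MeasurableSet W := measurableSet_ball.diff measurableSet_ball
  have full : ∫ z : E 4, W.indicator (fun z => ‖z‖^(-4:ℝ)) z = 2 * Real.pi^2 * Real.log (δ/ρ) := by
    have : ∀ z : E 4, W.indicator (fun z => ‖z‖^(-4:ℝ)) z = (Set.Ico ρ δ).indicator (fun r => r^(-4:ℝ)) ‖z‖ := by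
      intro z
      by_cases h : z ∈ W
      · rw [Set.indicator_of_mem h, Set.indicator_of_mem]
        simpa [W, and_comm] using h
      · rw [Set.indicator_of_notMem h, Set.indicator_of_notMem]
        simpa [W, and_comm] using h
    simp_rw [this]
    rw [rad_formula]
    congr 1
    have : ∀ r ∈ Set.Ioi (0:ℝ), r^3 * (Set.Ico ρ δ).indicator (fun r => r^(-4:ℝ)) r = (Set.Ico ρ δ).indicator (fun r => r⁻¹) r := by
      intro r hr
      have hr : 0 < r := hr
      by_cases h : r ∈ Set.Ico ρ δ
      · rw [Set.indicator_of_mem h, Set.indicator_of_mem h]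
        rw [Real.rpow_neg hr.le, show (4:ℝ) = ((4:ℕ):ℝ) by norm_num, Real.rpow_natCast]
        field_simp
      · rw [Set.indicator_of_notMem h, Set.indicator_of_notMem h, mul_zero]
    rw [setIntegral_congr_fun measurableSet_Ioi this, setIntegral_indicator measurableSet_Ico]
    rw [Set.inter_eq_right.2 (show Set.Ico ρ δ ⊆ Set.Ioi 0 from fun r hr => lt_of_lt_of_le hρ hr.1), integral_Ico_eq_integral_Ioo, ← integral_Ioc_eq_integral_Ioo, ← intervalIntegral.integral_of_le hδ]
    rw [integral_inv_of_pos hρ (by linarith)]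
  set g : E 4 → ℝ := fun z => S.indicator (fun y : E 4 => ‖y - ξ‖^(-4:ℝ)) (z + ξ) with hg
  have hgS : ∫ z, g z = ∫ y in S, ‖y - ξ‖^(-4:ℝ) := by
    rw [hg, integral_add_right_eq_self (fun y => S.indicator (fun y : E 4 => ‖y - ξ‖^(-4:ℝ)) y) ξ, integral_indicator hms]
  have hgi : Integrable g := ((integrable_indicator_iff hms).2 (hIntg S hms Set.inter_subset_right)).comp_add_right ξ
  have hle : ∀ z, g z + g (-z) ≤ W.indicator (fun z => ‖z‖^(-4:ℝ)) z := by
    intro z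
    by_cases h1 : z + ξ ∈ S
    · have h2 : -z + ξ ∉ S := by
        intro h2
        have a1 : ‖z + ξ‖ < 1 := by simpa using h1.1
        have a2 : ‖-z + ξ‖ < 1 := by simpa using h2.1
        have a3 : ‖(z + ξ) + (-z + ξ)‖ = 2 := by
          rw [show (z + ξ) + (-z + ξ) = (2:ℝ) • ξ by rw [two_smul]; abel, norm_smul, hξ]; simp
        have := norm_add_le (z + ξ) (-z + ξ)
        linarith
      have h3 : z ∈ W := by
        have := h1.2
        simpa [W, dist_eq_norm] using this
      simp only [hg]
      rw [Set.indicator_of_mem h1, Set.indicator_of_notMem h2, Set.indicator_of_mem h3]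
      simp
    · have h0 : 0 ≤ W.indicator (fun z => ‖z‖^(-4:ℝ)) z := Set.indicator_nonneg (fun _ _ => by positivity) _
      simp only [hg]
      rw [Set.indicator_of_notMem h1, zero_add]
      by_cases h2 : -z + ξ ∈ S
      · have h3 : z ∈ W := by
          have := h2.2
          simpa [W, dist_eq_norm] using this
        rw [Set.indicator_of_mem h2, Set.indicator_of_mem h3]
        simp
      · rw [Set.indicator_of_notMem h2]; exact h0
  have hWi : Integrable (W.indicator (fun z : E 4 => ‖z‖^(-4:ℝ))) := by
    rw [integrable_indicator_iff hW]
    refine Measure.integrableOn_of_bounded (M := ρ^(-4:ℝ)) ?_ ?_ ?_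
    · exact (lt_of_le_of_lt (measure_mono (Set.sdiff_subset)) measure_ball_lt_top).ne
    · exact (Measurable.aestronglyMeasurable (by fun_prop))
    · filter_upwards [ae_restrict_mem hW] with y hy
      have := hy.2
      simp only [mem_ball, dist_zero_right, not_lt] at this
      rw [Real.norm_of_nonneg (by positivity)]
      exact Real.rpow_le_rpow_of_nonpos hρ this (by norm_num)
  have h5 := integral_mono (hgi.add hgi.comp_neg) hWi hle
  rw [integral_add' hgi hgi.comp_neg, integral_neg_eq_self, full, hgS] at h5
  linarith

lemma sph_integrable {g : E 4 → ℝ} (hg : ContinuousOn g (sphere 0 1)) : Integrable g (sphMeasure 4) := by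
  have h1 : IntegrableOn g (sphere 0 1) (sphMeasure 4) := hg.integrableOn_compact (isCompact_sphere _ _)
  rwa [IntegrableOn, Measure.restrict_eq_self_of_ae_mem] at h1
  filter_upwards [sph_ae] with y hy
  simpa using hy

lemma tyx_ge {t : ℝ} {ξ y : E 4} (hξ : ‖ξ‖ = 1) (hy : ‖y‖ ≤ 1) : 1 - |t| ≤ ‖t • y - ξ‖ := by
  have : ‖ξ‖ - ‖t • y‖ ≤ ‖t • y - ξ‖ := by rw [norm_sub_rev]; exact norm_sub_norm_le _ _
  rw [norm_smul, hξ, Real.norm_eq_abs] at this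
  nlinarith [abs_nonneg t]

lemma tyx_ge2 {t : ℝ} {ξ y : E 4} (hξ : ‖ξ‖ = 1) (ht0 : 0 ≤ t) (ht1 : t < 1) (hy : ‖y‖ ≤ 1) : ‖y - ξ‖ ≤ 2 * ‖t • y - ξ‖ := by
  have h1 := tyx_ge (t := t) hξ hy
  rw [abs_of_nonneg ht0] at h1
  have h2 : ‖y - ξ‖ ≤ ‖t • y - ξ‖ + ‖(1 - t) • y‖ := by
    have : y - ξ = (t • y - ξ) + (1 - t) • y := by rw [sub_smul, one_smul]; abel
    conv_lhs => rw [this]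
    exact norm_add_le _ _
  rw [norm_smul, Real.norm_eq_abs, abs_of_pos (by linarith : 0 < 1 - t)] at h2
  nlinarith

lemma Hk_nonneg (t : ℝ) (ξ y : E 4) : 0 ≤ Hk t ξ y := by unfold Hk; positivity

lemma Hk_meas (t : ℝ) (ξ : E 4) : Measurable (Hk t ξ) := by unfold Hk; fun_prop

lemma Hk_contOn {t : ℝ} {ξ : E 4} (hξ : ‖ξ‖ = 1) (ht : |t| < 1) : ContinuousOn (Hk t ξ) (closedBall 0 1) := by
  unfold Hk
  apply ContinuousOn.inv₀ (by fun_prop)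
  intro y hy
  have := tyx_ge (t := t) hξ (by simpa using hy)
  have : 0 < ‖t • y - ξ‖ := by linarith
  positivity

lemma sph_sub : sphere (0 : E 4) 1 ⊆ closedBall 0 1 := sphere_subset_closedBall

lemma A_der {t : ℝ} {ξ : E 4} (hξ : ‖ξ‖ = 1) (ht : |t| < 1) (u : E 4 → ℝ) (hu : Continuous u) :
    HasDerivAt (fun t => ∫ y, u y * Hk t ξ y ∂(sphMeasure 4))
      (-∫ y, u y * (2 * ⟪t • y - ξ, y⟫ * (Hk t ξ y)^2) ∂(sphMeasure 4)) t := by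
  obtain ⟨a, ha1, ha2⟩ := exists_between ht
  have ha0 : 0 < a := lt_of_le_of_lt (abs_nonneg t) ha1
  obtain ⟨M, hM⟩ := (isCompact_sphere (0 : E 4) 1).exists_bound_of_continuousOn hu.continuousOn
  rw [← integral_neg]
  refine (hasDerivAt_integral_of_dominated_loc_of_deriv_le (s := {t | |t| < a})
    (F' := fun t y => -(u y * (2 * ⟪t • y - ξ, y⟫ * (Hk t ξ y)^2))) (bound := fun _ => M * (4 * ((1-a)^4)⁻¹)) ?_ ?_ ?_ ?_ ?_ ?_ ?_).2
  · exact (isOpen_lt (by fun_prop) (by fun_prop)).mem_nhds ha1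
  · exact Eventually.of_forall fun x => (hu.measurable.mul (Hk_meas x ξ)).aestronglyMeasurable
  · exact sph_integrable (hu.continuousOn.mul ((Hk_contOn hξ ht).mono sph_sub))
  · have := Hk_meas t ξ
    have := hu.measurable
    apply Measurable.aestronglyMeasurable
    fun_prop
  · filter_upwards [sph_ae] with y hy x hx
    have hx : |x| < a := hx
    have h1 := hM y (by simpa using hy)
    have h2 := tyx_ge (t := x) (ξ := ξ) (y := y) hξ (by linarith)
    have hM0 : 0 ≤ M := (norm_nonneg _).trans h1
    rw [norm_neg, norm_mul]
    refine mul_le_mul h1 ?_ (norm_nonneg _) hM0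
    have h3 : |⟪x • y - ξ, y⟫| ≤ 2 := by
      refine (abs_real_inner_le_norm _ _).trans ?_
      have := norm_sub_le (x • y) ξ
      rw [norm_smul, hξ, hy, Real.norm_eq_abs] at this
      rw [hy]; linarith
    rw [norm_mul, norm_mul, Real.norm_eq_abs, Real.norm_eq_abs, Real.norm_eq_abs]
    have h4 : |Hk x ξ y ^ 2| ≤ ((1-a)^4)⁻¹ := by
      rw [abs_of_nonneg (by positivity)]
      unfold Hk
      rw [inv_pow, ← pow_mul]
      have : 0 < 1 - a := by linarith
      gcongr
      linarith
    have : |(2:ℝ)| = 2 := by norm_num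
    rw [this]
    refine mul_le_mul (by linarith) h4 (abs_nonneg _) (by norm_num)
  · exact integrable_const _
  · filter_upwards [sph_ae] with y hy x hx
    have hx : |x| < a := hx
    have h2 := tyx_ge (t := x) (ξ := ξ) (y := y) hξ (by linarith)
    have h3 : 0 < ‖x • y - ξ‖ := by linarith
    have e : HasDerivAt (fun t : ℝ => t • y - ξ) y x := by
      simpa using ((hasDerivAt_id x).smul_const y).sub_const ξ
    have e2 := e.norm_sq
    have e3 := (e2.inv (by positivity)).const_mul (u y)
    refine e3.congr_deriv ?_
    unfold Hk
    field_simp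

lemma A_bound {t : ℝ} {ξ : E 4} (hξ : ‖ξ‖ = 1) (ht0 : 0 < t) (ht1 : t < 1) (u : E 4 → ℝ) (hu : ContDiff ℝ 2 u)
    (hneu : ∀ x ∈ sphere 0 1, fderiv ℝ u x x = 0) (hL : Continuous (lap 4 u)) :
    |∫ y, u y * (2 * ⟪t • y - ξ, y⟫ * (Hk t ξ y)^2) ∂(sphMeasure 4)| ≤
      3 * √(32 * Real.pi^2) * √(∫ x in ball 0 1, lap 4 u x ^ 2) * (√(1 - t))⁻¹ := by
  have h1 := green_t hξ ht0.le ht1 u hu hneu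
  have h0 := green_t hξ le_rfl zero_lt_one u hu hneu
  have e0 : ∀ x, Hk 0 ξ x = 1 := by intro x; simp [Hk, hξ]
  simp only [e0, one_mul, zero_mul] at h0
  have i1 : IntegrableOn (fun x => Hk t ξ x * lap 4 u x) (ball 0 1) :=
    (((Hk_contOn hξ (by rwa [abs_of_pos ht0])).mul hL.continuousOn).integrableOn_compact (isCompact_closedBall _ _)).mono_set ball_subset_closedBall
  have i2 : IntegrableOn (fun x => Hk t ξ x ^ 2) (ball 0 1) :=
    (((Hk_contOn hξ (by rwa [abs_of_pos ht0])).pow 2).integrableOn_compact (isCompact_closedBall _ _)).mono_set ball_subset_closedBall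
  have h2 : t * ∫ y, u y * (2 * ⟪t • y - ξ, y⟫ * (Hk t ξ y)^2) ∂(sphMeasure 4) = ∫ x in ball 0 1, (Hk t ξ x - 1) * lap 4 u x := by
    rw [← h1, ← sub_zero (∫ x in ball 0 1, Hk t ξ x * lap 4 u x), ← h0, ← integral_sub i1 (ball_int hL)]
    congr 1; ext x; ring
  have h3 : |∫ x in ball 0 1, (Hk t ξ x - 1) * lap 4 u x| ≤ ∫ x in ball 0 1, 3 * t * (Hk t ξ x * |lap 4 u x|) := by
    refine (abs_integral_le_integral_abs).trans ?_
    apply setIntegral_mono_on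
    · have : IntegrableOn (fun x => (Hk t ξ x - 1) * lap 4 u x) (ball 0 1) := by
        refine (i1.sub (ball_int hL)).congr (Eventually.of_forall fun x => ?_)
        simp only [Pi.sub_apply]; ring
      exact this.abs
    · apply Integrable.const_mul
      refine i1.abs.congr (Eventually.of_forall fun x => ?_)
      simp only [abs_mul, abs_of_nonneg (Hk_nonneg t ξ x)]
    · exact measurableSet_ball
    · intro x hx
      have hx : ‖x‖ < 1 := by simpa using hx
      rw [abs_mul, ← mul_assoc]
      gcongr
      have h4 := tyx_ge (t := t) hξ hx.le
      rw [abs_of_pos ht0] at h4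
      have h5 : 0 < ‖t • x - ξ‖ := by linarith
      have h6 : ‖t • x - ξ‖^2 = t^2 * ‖x‖^2 - 2 * t * ⟪x, ξ⟫ + 1 := by
        rw [norm_sub_sq_real, norm_smul, hξ, inner_smul_left, Real.norm_eq_abs, abs_of_pos ht0]
        simp; ring
      have h7 : |1 - ‖t • x - ξ‖^2| ≤ 3 * t := by
        have := abs_real_inner_le_norm x ξ
        rw [hξ, mul_one] at this
        have := abs_le.1 (this.trans hx.le)
        rw [h6, abs_le]
        have : ‖x‖^2 ≤ 1 := by nlinarith [norm_nonneg x]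
        have : t^2 * ‖x‖^2 ≤ t := by nlinarith [sq_nonneg ‖x‖]
        have : 0 ≤ t^2 * ‖x‖^2 := by positivity
        constructor <;> nlinarith
      have h8 : Hk t ξ x - 1 = (1 - ‖t • x - ξ‖^2) * Hk t ξ x := by
        unfold Hk; field_simp
      rw [h8, abs_mul, abs_of_nonneg (Hk_nonneg t ξ x)]
      exact mul_le_mul_of_nonneg_right h7 (Hk_nonneg t ξ x)
  rw [← h2, abs_mul, abs_of_pos ht0, integral_const_mul] at h3
  have h4 : ∫ x in ball 0 1, Hk t ξ x * |lap 4 u x| ≤ √(∫ x in ball 0 1, Hk t ξ x ^ 2) * √(∫ x in ball 0 1, lap 4 u x ^ 2) := by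
    have := CS (volume.restrict (ball 0 1)) (Hk t ξ) (fun x => |lap 4 u x|) (Eventually.of_forall (Hk_nonneg t ξ)) (Eventually.of_forall fun x => abs_nonneg _)
      (Hk_meas t ξ).aestronglyMeasurable hL.abs.aestronglyMeasurable i2 (by simpa using! ball_int (hL.pow 2))
    simpa using this
  have h5 : ∫ x in ball 0 1, Hk t ξ x ^ 2 ≤ 32 * Real.pi^2 * (1-t)⁻¹ := by
    have r := rad_int ξ (a := 3) (R := 2) (by norm_num) (by norm_num)
    have hs : ball (0 : E 4) 1 ⊆ ball ξ 2 := by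
      apply ball_subset_ball'; simp [hξ]; norm_num
    have r2 : ∫ y in ball 0 1, ‖y - ξ‖^(-3:ℝ) ≤ ∫ y in ball ξ 2, ‖y - ξ‖^(-3:ℝ) :=
      setIntegral_mono_set r.1 (Eventually.of_forall fun x => by simp only [Pi.zero_apply]; positivity) (LE.le.eventuallyLE hs)
    have r3 : ∫ y in ball ξ 2, ‖y - ξ‖^(-3:ℝ) = 4 * Real.pi^2 := by
      rw [r.2]; norm_num; ring
    have r4 : ∫ x in ball 0 1, Hk t ξ x ^ 2 ≤ ∫ y in ball 0 1, (1-t)⁻¹ * 8 * ‖y - ξ‖^(-3:ℝ) := by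
      apply setIntegral_mono_on i2 ((r.1.mono_set hs).const_mul _) measurableSet_ball
      intro x hx
      have hx : ‖x‖ < 1 := by simpa using hx
      have h4 := tyx_ge (t := t) hξ hx.le
      rw [abs_of_pos ht0] at h4
      have h5 : 0 < ‖t • x - ξ‖ := by linarith
      have h6 := tyx_ge2 hξ ht0.le ht1 hx.le
      have h7 : 0 < ‖x - ξ‖ := by simpa using tyx_pos (t := 1) hξ (by norm_num) (by simpa using hx)
      rw [Real.rpow_neg (norm_nonneg _), show (3:ℝ) = ((3:ℕ):ℝ) by norm_num, Real.rpow_natCast]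
      unfold Hk
      have h8 : 0 < 1 - t := by linarith
      have h9 : ‖x - ξ‖^3 ≤ (2 * ‖t • x - ξ‖)^3 := by gcongr
      have h10 : (1 - t) * ‖x - ξ‖^3 ≤ ‖t • x - ξ‖ * (2 * ‖t • x - ξ‖)^3 := by gcongr
      rw [inv_pow, inv_le_iff_one_le_mul₀ (by positivity)]
      rw [show (1 - t)⁻¹ * 8 * (‖x - ξ‖ ^ 3)⁻¹ * (‖t • x - ξ‖ ^ 2) ^ 2 = (‖t • x - ξ‖ * (2 * ‖t • x - ξ‖)^3) / ((1-t) * ‖x - ξ‖^3) by field_simp; ring]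
      rw [one_le_div (by positivity)]
      exact h10
    rw [integral_const_mul] at r4
    refine r4.trans ?_
    have : 0 < (1-t)⁻¹ := by have : 0 < 1 - t := by linarith
                             positivity
    nlinarith
  have h6 : √(∫ x in ball 0 1, Hk t ξ x ^ 2) ≤ √(32 * Real.pi^2) * (√(1 - t))⁻¹ := by
    rw [← Real.sqrt_inv, ← Real.sqrt_mul (by positivity)]
    exact Real.sqrt_le_sqrt h5
  have h7 : t * |∫ y, u y * (2 * ⟪t • y - ξ, y⟫ * (Hk t ξ y)^2) ∂(sphMeasure 4)| ≤ t * (3 * √(32 * Real.pi^2) * √(∫ x in ball 0 1, lap 4 u x ^ 2) * (√(1 - t))⁻¹) := by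
    refine h3.trans ?_
    have h8 := h4.trans (mul_le_mul_of_nonneg_right h6 (Real.sqrt_nonneg _))
    have h9 := mul_le_mul_of_nonneg_left h8 (by positivity : 0 ≤ 3 * t)
    refine h9.trans (le_of_eq ?_)
    ring
  exact le_of_mul_le_mul_left h7 ht0

lemma A_diff {t : ℝ} {ξ : E 4} (hξ : ‖ξ‖ = 1) (ht0 : 0 ≤ t) (ht1 : t < 1) (u : E 4 → ℝ) (hu : ContDiff ℝ 2 u)
    (hneu : ∀ x ∈ sphere 0 1, fderiv ℝ u x x = 0) (hL : Continuous (lap 4 u)) :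
    |∫ y, u y * Hk t ξ y ∂(sphMeasure 4) - ∫ y, u y ∂(sphMeasure 4)| ≤
      6 * √(32 * Real.pi^2) * √(∫ x in ball 0 1, lap 4 u x ^ 2) := by
  set D := 3 * √(32 * Real.pi^2) * √(∫ x in ball 0 1, lap 4 u x ^ 2) with hD
  have hD0 : 0 ≤ D := by positivity
  set A : ℝ → ℝ := fun t => ∫ y, u y * Hk t ξ y ∂(sphMeasure 4) with hA
  have hder : ∀ t ∈ Set.Ico (0:ℝ) 1, HasDerivAt A (-∫ y, u y * (2 * ⟪t • y - ξ, y⟫ * (Hk t ξ y)^2) ∂(sphMeasure 4)) t := by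
    intro t ht
    exact A_der hξ (by rw [abs_of_nonneg ht.1]; exact ht.2) u hu.continuous
  set B : ℝ → ℝ := fun t => 2 * D * (1 - √(1 - t)) with hB
  have hBd : ∀ t ∈ Set.Ico (0:ℝ) 1, HasDerivAt B (D * (√(1 - t))⁻¹) t := by
    intro t ht
    have h1 : 0 < 1 - t := by linarith [ht.2]
    have := ((((hasDerivAt_id t).const_sub 1).sqrt h1.ne').const_sub 1).const_mul (2 * D)
    refine this.congr_deriv ?_
    simp only [id]
    field_simp
  have key : ∀ s : ℝ, |s| = 1 → MonotoneOn (fun t => B t + s * A t) (Set.Ico 0 1) := by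
    intro s hs
    apply monotoneOn_of_deriv_nonneg (convex_Ico 0 1)
    · intro t ht
      exact ((hBd t ht).add ((hder t ht).const_mul s)).continuousAt.continuousWithinAt
    · intro t ht
      rw [interior_Ico] at ht
      exact ((hBd t ⟨ht.1.le, ht.2⟩).add ((hder t ⟨ht.1.le, ht.2⟩).const_mul s)).differentiableAt.differentiableWithinAt
    · intro t ht
      rw [interior_Ico] at ht
      have h1 := ((hBd t ⟨ht.1.le, ht.2⟩).add ((hder t ⟨ht.1.le, ht.2⟩).const_mul s)).deriv
      erw [h1]
      have h2 := A_bound hξ ht.1 ht.2 u hu hneu hL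
      rw [← hD] at h2
      have h3 : |s * (-∫ y, u y * (2 * ⟪t • y - ξ, y⟫ * (Hk t ξ y)^2) ∂(sphMeasure 4))| ≤ D * (√(1 - t))⁻¹ := by
        rw [abs_mul, hs, one_mul, abs_neg]; exact h2
      linarith [(abs_le.1 h3).1]
  have e0 : A 0 = ∫ y, u y ∂(sphMeasure 4) := by
    simp [hA, Hk, hξ]
  have eB : B 0 = 0 := by simp [hB]
  have hBt : B t ≤ 2 * D := by
    have : 0 ≤ √(1-t) := Real.sqrt_nonneg _
    simp only [hB]; nlinarith
  have k1 := key 1 (by norm_num) ⟨le_rfl, zero_lt_one⟩ ⟨ht0, ht1⟩ ht0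
  have k2 := key (-1) (by norm_num) ⟨le_rfl, zero_lt_one⟩ ⟨ht0, ht1⟩ ht0
  simp only [e0, eB] at k1 k2
  change |A t - _| ≤ _
  rw [abs_le]
  constructor <;> · rw [hD] at hBt; linarith

lemma sph_ident {t : ℝ} {ξ : E 4} (hξ : ‖ξ‖ = 1) (ht0 : 0 ≤ t) (ht1 : t < 1) (u : E 4 → ℝ) (hu : ContDiff ℝ 2 u)
    (hneu : ∀ x ∈ sphere 0 1, fderiv ℝ u x x = 0) :
    (1 - t^2) * ∫ y, u y * (Hk t ξ y)^2 ∂(sphMeasure 4) = ∫ y, u y * Hk t ξ y ∂(sphMeasure 4) -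
      ∫ x in ball 0 1, Hk t ξ x * lap 4 u x := by
  have hc := (Hk_contOn hξ (by rwa [abs_of_nonneg ht0])).mono sph_sub
  rw [green_t hξ ht0 ht1 u hu hneu, ← integral_const_mul, ← integral_const_mul, ← integral_sub]
  · apply integral_congr_ae
    filter_upwards [sph_ae] with y hy
    have h4 := tyx_pos (y := y) hξ ht0 (by rw [hy]; linarith)
    have h6 : ‖t • y - ξ‖^2 = t^2 - 2 * t * ⟪y, ξ⟫ + 1 := by
      rw [norm_sub_sq_real, norm_smul, hξ, inner_smul_left, Real.norm_eq_abs, abs_of_nonneg ht0, hy]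
      simp; ring
    have h7 : ⟪t • y - ξ, y⟫ = t - ⟪y, ξ⟫ := by
      rw [inner_sub_left, inner_smul_left, real_inner_self_eq_norm_sq, hy, real_inner_comm]
      simp
    rw [h7]
    have h8 : Hk t ξ y = (t^2 - 2 * t * ⟪y, ξ⟫ + 1) * (Hk t ξ y)^2 := by
      rw [← h6]; unfold Hk; field_simp
    conv_rhs => enter [1]; rw [h8]
    ring
  · exact sph_integrable (hu.continuous.continuousOn.mul hc)
  · refine sph_integrable (ContinuousOn.mul (by fun_prop) (hu.continuous.continuousOn.mul (ContinuousOn.mul (by fun_prop) (hc.pow 2))))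

lemma lap_const (c : ℝ) (x : E 4) : lap 4 (fun _ => c) x = 0 := by simp [lap]

lemma Pk_one {t : ℝ} {ξ : E 4} (hξ : ‖ξ‖ = 1) (ht0 : 0 ≤ t) (ht1 : t < 1) :
    (1 - t^2) * ∫ y, (Hk t ξ y)^2 ∂(sphMeasure 4) = 2 * Real.pi^2 := by
  have hl : lap 4 (fun _ => (1:ℝ)) = fun _ => 0 := by ext x; exact lap_const 1 x
  have h1 := sph_ident hξ ht0 ht1 (fun _ => 1) contDiff_const (by simp)
  have h2 := A_diff hξ ht0 ht1 (fun _ => 1) contDiff_const (by simp) (by rw [hl]; exact continuous_const)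
  simp only [hl, one_mul, mul_zero, integral_zero, sub_zero] at h1 h2
  rw [h1]
  simp [sph_univ] at h2
  linarith [abs_nonpos_iff.1 (le_of_eq (abs_eq_zero.2 h2))]

lemma Pk_lim {ξ : E 4} (hξ : ‖ξ‖ = 1) (u : E 4 → ℝ) (hu : Continuous u) :
    Tendsto (fun t : ℝ => (1 - t^2) * ∫ y, u y * (Hk t ξ y)^2 ∂(sphMeasure 4)) (nhdsWithin 1 (Set.Iio 1))
      (nhds (2 * Real.pi^2 * u ξ)) := by
  obtain ⟨M, hM⟩ := (isCompact_sphere (0 : E 4) 1).exists_bound_of_continuousOn hu.continuousOn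
  have hM0 : 0 ≤ M := (norm_nonneg _).trans (hM ξ (by simpa using hξ))
  rw [Metric.tendsto_nhds]
  intro ε hε
  set η := ε / (4 * Real.pi^2) with hη
  have hη0 : 0 < η := by positivity
  obtain ⟨δ, hδ0, hδ⟩ := Metric.continuous_iff.1 hu ξ η hη0
  set c := 2 * M / δ^4 with hc
  have hc0 : 0 ≤ c := by positivity
  have hpt : ∀ t : ℝ, 0 ≤ t → t < 1 → ∀ y : E 4, ‖y‖ = 1 → |u y - u ξ| * (Hk t ξ y)^2 ≤ η * (Hk t ξ y)^2 + 16 * c := by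
    intro t ht0 ht1 y hy
    have hb : |u y - u ξ| ≤ η + c * ‖y - ξ‖^4 := by
      by_cases h : ‖y - ξ‖ < δ
      · have := hδ y (by rwa [dist_eq_norm])
        rw [Real.dist_eq] at this
        have : 0 ≤ c * ‖y - ξ‖^4 := by positivity
        linarith
      · push Not at h
        have h1 : |u y - u ξ| ≤ 2 * M := by
          have a1 := hM y (by simpa using hy)
          have a2 := hM ξ (by simpa using hξ)
          rw [Real.norm_eq_abs] at a1 a2
          exact (abs_sub _ _).trans (by linarith)
        have h2 : 2 * M ≤ c * ‖y - ξ‖^4 := by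
          rw [hc, div_mul_eq_mul_div, le_div_iff₀ (by positivity)]
          gcongr
        linarith
    have h4 := tyx_pos (y := y) hξ ht0 (by rw [hy]; linarith)
    have h5 : ‖y - ξ‖^4 * (Hk t ξ y)^2 ≤ 16 := by
      have h6 := tyx_ge2 (y := y) hξ ht0 ht1 hy.le
      have : ‖y - ξ‖^4 ≤ (2 * ‖t • y - ξ‖)^4 := by gcongr
      unfold Hk
      rw [inv_pow, ← div_eq_mul_inv, div_le_iff₀ (by positivity)]
      refine this.trans (le_of_eq ?_); ring
    calc |u y - u ξ| * (Hk t ξ y)^2 ≤ (η + c * ‖y - ξ‖^4) * (Hk t ξ y)^2 := by gcongr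
      _ = η * (Hk t ξ y)^2 + c * (‖y - ξ‖^4 * (Hk t ξ y)^2) := by ring
      _ ≤ _ := by nlinarith
  have hmain : ∀ t : ℝ, 0 ≤ t → t < 1 → |(1 - t^2) * ∫ y, u y * (Hk t ξ y)^2 ∂(sphMeasure 4) - 2 * Real.pi^2 * u ξ| ≤ ε/2 + (1 - t^2) * (32 * c * Real.pi^2) := by
    intro t ht0 ht1
    have hcH := (Hk_contOn (t := t) hξ (by rwa [abs_of_nonneg ht0])).mono sph_sub
    have i1 : Integrable (fun y => (Hk t ξ y)^2) (sphMeasure 4) := sph_integrable (hcH.pow 2)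
    have i2 : Integrable (fun y => u y * (Hk t ξ y)^2) (sphMeasure 4) := sph_integrable (hu.continuousOn.mul (hcH.pow 2))
    have i3 : Integrable (fun y => |u y - u ξ| * (Hk t ξ y)^2) (sphMeasure 4) := sph_integrable (ContinuousOn.mul (by fun_prop) (hcH.pow 2))
    have ht : 0 ≤ 1 - t^2 := by nlinarith
    have e : (1 - t^2) * ∫ y, u y * (Hk t ξ y)^2 ∂(sphMeasure 4) - 2 * Real.pi^2 * u ξ = (1-t^2) * ∫ y, (u y - u ξ) * (Hk t ξ y)^2 ∂(sphMeasure 4) := by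
      have : ∫ y, (u y - u ξ) * (Hk t ξ y)^2 ∂(sphMeasure 4) = ∫ y, u y * (Hk t ξ y)^2 ∂(sphMeasure 4) - u ξ * ∫ y, (Hk t ξ y)^2 ∂(sphMeasure 4) := by
        rw [← integral_const_mul, ← integral_sub i2 (i1.const_mul _)]
        congr 1; ext y; ring
      rw [this, ← Pk_one hξ ht0 ht1]; ring
    rw [e, abs_mul, abs_of_nonneg ht]
    have h1 : |∫ y, (u y - u ξ) * (Hk t ξ y)^2 ∂(sphMeasure 4)| ≤ η * ∫ y, (Hk t ξ y)^2 ∂(sphMeasure 4) + 32 * c * Real.pi^2 := by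
      refine abs_integral_le_integral_abs.trans ?_
      have : ∫ y, |(u y - u ξ) * (Hk t ξ y)^2| ∂(sphMeasure 4) ≤ ∫ y, (η * (Hk t ξ y)^2 + 16 * c) ∂(sphMeasure 4) := by
        apply integral_mono_ae
        · refine i3.congr (Eventually.of_forall fun y => ?_)
          simp only [abs_mul]; rw [abs_of_nonneg (sq_nonneg (Hk t ξ y))]
        · exact (i1.const_mul _).add (integrable_const _)
        · filter_upwards [sph_ae] with y hy
          rw [abs_mul, abs_of_nonneg (sq_nonneg (Hk t ξ y))]
          exact hpt t ht0 ht1 y hy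
      refine this.trans (le_of_eq ?_)
      rw [integral_add (i1.const_mul _) (integrable_const _), integral_const_mul, integral_const, sph_univ]
      simp; ring
    have h2 := mul_le_mul_of_nonneg_left h1 ht
    refine h2.trans (le_of_eq ?_)
    rw [mul_add, mul_left_comm, Pk_one hξ ht0 ht1, hη]
    field_simp; ring
  have hl : Tendsto (fun t : ℝ => ε/2 + (1 - t^2) * (32 * c * Real.pi^2)) (nhdsWithin 1 (Set.Iio 1)) (nhds (ε/2 + (1 - 1^2) * (32 * c * Real.pi^2))) := by
    apply Tendsto.mono_left _ nhdsWithin_le_nhds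
    apply Continuous.tendsto; fun_prop
  have hlt : ε/2 + (1 - 1^2) * (32 * c * Real.pi^2) < ε := by simp; linarith
  filter_upwards [hl.eventually_lt_const hlt, self_mem_nhdsWithin, mem_nhdsWithin_of_mem_nhds (lt_mem_nhds zero_lt_one)] with t h1 h2 h3
  rw [Real.dist_eq]
  exact (hmain t (le_of_lt h3) h2).trans_lt h1

lemma I_lim {ξ : E 4} (hξ : ‖ξ‖ = 1) (L : E 4 → ℝ) (hL : Continuous L) :
    IntegrableOn (fun x => ‖x - ξ‖^(-2:ℝ) * |L x|) (ball 0 1) ∧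
    Tendsto (fun t : ℝ => ∫ x in ball 0 1, Hk t ξ x * |L x|) (nhdsWithin 1 (Set.Iio 1))
      (nhds (∫ x in ball 0 1, ‖x - ξ‖^(-2:ℝ) * |L x|)) := by
  have r := rad_int ξ (a := 2) (R := 2) (by norm_num) (by norm_num)
  have hs : ball (0 : E 4) 1 ⊆ ball ξ 2 := by
    apply ball_subset_ball'; simp [hξ]; norm_num
  obtain ⟨M, hM⟩ := (isCompact_closedBall (0 : E 4) 1).exists_bound_of_continuousOn hL.continuousOn
  have hIntg : IntegrableOn (fun x => ‖x - ξ‖^(-2:ℝ) * |L x|) (ball 0 1) := by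
    refine Integrable.mul_bdd (c := M) (r.1.mono_set hs) hL.abs.aestronglyMeasurable ?_
    filter_upwards [ae_restrict_mem measurableSet_ball] with x hx
    simpa using hM x (ball_subset_closedBall hx)
  refine ⟨hIntg, ?_⟩
  apply tendsto_integral_filter_of_dominated_convergence (fun x => 4 * (‖x - ξ‖^(-2:ℝ) * |L x|))
  · exact Eventually.of_forall fun t => ((Hk_meas t ξ).mul hL.abs.measurable).aestronglyMeasurable
  · filter_upwards [self_mem_nhdsWithin, mem_nhdsWithin_of_mem_nhds (lt_mem_nhds zero_lt_one)] with t h2 h3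
    filter_upwards [ae_restrict_mem measurableSet_ball] with x hx
    have hx : ‖x‖ < 1 := by simpa using hx
    have h2 : t < 1 := h2
    have h3 : 0 < t := h3
    have h4 := tyx_pos (y := x) (t := t) hξ h3.le (by nlinarith [norm_nonneg x])
    have h6 := tyx_ge2 hξ h3.le h2 hx.le
    have h7 : 0 < ‖x - ξ‖ := by simpa using tyx_pos (t := 1) hξ (by norm_num) (by simpa using hx)
    rw [norm_mul, Real.norm_eq_abs, Real.norm_eq_abs, abs_abs, abs_of_nonneg (Hk_nonneg _ _ _), ← mul_assoc]
    gcongr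
    rw [Real.rpow_neg (norm_nonneg _), show (2:ℝ) = ((2:ℕ):ℝ) by norm_num, Real.rpow_natCast]
    unfold Hk
    have : ‖x - ξ‖^2 ≤ (2 * ‖t • x - ξ‖)^2 := by gcongr
    rw [← div_eq_mul_inv, le_div_iff₀ (by positivity), inv_mul_le_iff₀ (by positivity)]
    refine this.trans (le_of_eq ?_); ring
  · exact hIntg.const_mul 4
  · filter_upwards [ae_restrict_mem measurableSet_ball] with x hx
    have hx : ‖x‖ < 1 := by simpa using hx
    have h7 : 0 < ‖x - ξ‖ := by simpa using tyx_pos (t := 1) hξ (by norm_num) (by simpa using hx)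
    apply Tendsto.mul_const
    apply Tendsto.mono_left _ nhdsWithin_le_nhds
    have : Tendsto (fun t => Hk t ξ x) (nhds 1) (nhds (Hk 1 ξ x)) := by
      unfold Hk
      apply Tendsto.inv₀
      · apply Continuous.tendsto (f := fun t : ℝ => ‖t • x - ξ‖^2); fun_prop
      · rw [one_smul]; positivity
    convert this using 2
    unfold Hk
    rw [Real.rpow_neg (norm_nonneg _), show (2:ℝ) = ((2:ℕ):ℝ) by norm_num, Real.rpow_natCast, one_smul]

lemma repr_bound {ξ : E 4} (hξ : ‖ξ‖ = 1) (u : E 4 → ℝ) (hu : ContDiff ℝ 2 u)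
    (hneu : ∀ x ∈ sphere 0 1, fderiv ℝ u x x = 0) (hL : Continuous (lap 4 u)) (hm : ∫ y, u y ∂(sphMeasure 4) = 0) :
    2 * Real.pi^2 * |u ξ| ≤ (∫ x in ball 0 1, ‖x - ξ‖^(-2:ℝ) * |lap 4 u x|) +
      6 * √(32 * Real.pi^2) * √(∫ x in ball 0 1, lap 4 u x ^ 2) := by
  have l1 := (Pk_lim hξ u hu.continuous).abs
  have l2 := ((I_lim hξ _ hL).2).add_const (6 * √(32 * Real.pi^2) * √(∫ x in ball 0 1, lap 4 u x ^ 2))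
  have := le_of_tendsto_of_tendsto l1 l2 ?_
  · rw [abs_mul, abs_of_nonneg (by positivity)] at this
    exact this
  filter_upwards [self_mem_nhdsWithin, mem_nhdsWithin_of_mem_nhds (lt_mem_nhds zero_lt_one)] with t h2 h3
  have h2 : t < 1 := h2
  have h3 : 0 < t := h3
  rw [sph_ident hξ h3.le h2 u hu hneu]
  have h5 := A_diff hξ h3.le h2 u hu hneu hL
  rw [hm, sub_zero] at h5
  have h6 : |∫ x in ball 0 1, Hk t ξ x * lap 4 u x| ≤ ∫ x in ball 0 1, Hk t ξ x * |lap 4 u x| := by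
    refine abs_integral_le_integral_abs.trans (le_of_eq ?_)
    congr 1; ext x; rw [abs_mul, abs_of_nonneg (Hk_nonneg _ _ _)]
  exact (abs_sub _ _).trans (by linarith)

lemma sph_kernel {s : ℝ} (hs0 : 0 < s) (hs : s < 3) : ∃ C : ℝ, 0 ≤ C ∧ ∀ y : E 4, ‖y‖ < 1 →
    ∫⁻ ξ, ENNReal.ofReal (‖y - ξ‖^(-s)) ∂(sphMeasure 4) ≤ ENNReal.ofReal C := by
  set c : ℝ := (1/32) * (5/4)^(-(s+1)) with hc
  have hc0 : 0 < c := by positivity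
  set V : ℝ := 2 * Real.pi^2 * (3^(4-(s+1))/(4-(s+1))) with hV
  have hV0 : 0 ≤ V := by
    have : 0 < 4 - (s+1) := by linarith
    positivity
  refine ⟨c⁻¹ * V, by positivity, fun y hy => ?_⟩
  set G : E 4 → ℝ≥0∞ := (ball y 3).indicator (fun z => ENNReal.ofReal (‖z - y‖^(-(s+1)))) with hG
  have hGm : Measurable G := Measurable.indicator (by fun_prop) measurableSet_ball
  have hGV : ∫⁻ z, G z = ENNReal.ofReal V := by
    have r := rad_int y (a := s+1) (R := 3) (by linarith) (by norm_num)
    rw [hG, lintegral_indicator measurableSet_ball, ← ofReal_integral_eq_lintegral_ofReal r.1 (Eventually.of_forall fun z => by simp only [Pi.zero_apply]; positivity), r.2]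
  have hsw : ∫⁻ z, G z = ∫⁻ ξ, (∫⁻ r in Set.Ioi (0:ℝ), ENNReal.ofReal (r^3) * G (r • ξ)) ∂(sphMeasure 4) := by
    rw [polar_lintegral G hGm, ← lintegral_lintegral_swap]
    · congr 1; ext r
      rw [lintegral_const_mul (f := fun y => G (r • y)) _ (hGm.comp (by fun_prop : Measurable fun y : E 4 => r • y))]
    · apply Measurable.aemeasurable
      apply Measurable.mul
      · fun_prop
      · exact hGm.comp (by fun_prop)
  have hlow : ∀ ξ : E 4, ‖ξ‖ = 1 → ENNReal.ofReal (c * ‖y - ξ‖^(-s)) ≤ ∫⁻ r in Set.Ioi (0:ℝ), ENNReal.ofReal (r^3) * G (r • ξ) := by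
    intro ξ hξ
    set d := ‖y - ξ‖ with hd
    have hd0 : 0 < d := by simpa [hd] using tyx_pos (t := 1) hξ (by norm_num) (by simpa using hy)
    have hd2 : d < 2 := by
      have := norm_sub_le y ξ
      rw [hξ] at this; linarith
    have hsub : Set.Icc (1 - d/4) 1 ⊆ Set.Ioi (0:ℝ) := by
      intro r hr
      have := hr.1
      simp only [Set.mem_Ioi]; linarith
    calc ENNReal.ofReal (c * d^(-s)) = ∫⁻ r in Set.Icc (1 - d/4) 1, ENNReal.ofReal ((1/8) * ((5/4)*d)^(-(s+1))) := by
          rw [lintegral_const, Measure.restrict_apply_univ, Real.volume_Icc, ← ENNReal.ofReal_mul (by positivity)]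
          congr 1
          rw [hc, Real.mul_rpow (by norm_num) hd0.le, show -s = -(s+1) + 1 by ring, Real.rpow_add_one hd0.ne']
          ring_nf
      _ ≤ ∫⁻ r in Set.Icc (1 - d/4) 1, ENNReal.ofReal (r^3) * G (r • ξ) := by
          apply setLIntegral_mono' measurableSet_Icc
          intro r hr
          have h1 := hr.1
          have h2 := hr.2
          have h3 : 1/2 ≤ r := by linarith
          have h4 : ‖r • ξ - y‖ ≤ (5/4) * d := by
            have : r • ξ - y = (r - 1) • ξ + (ξ - y) := by rw [sub_smul, one_smul]; abel
            rw [this]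
            refine (norm_add_le _ _).trans ?_
            rw [norm_smul, hξ, Real.norm_eq_abs, abs_of_nonpos (by linarith), norm_sub_rev ξ y]
            linarith
          have h5 : r • ξ ∈ ball y 3 := by rw [mem_ball, dist_eq_norm]; linarith
          have h6 : 0 < ‖r • ξ - y‖ := by
            rw [norm_pos_iff, sub_ne_zero]
            intro h
            have hny : ‖y‖ = r := by rw [← h, norm_smul, hξ, Real.norm_eq_abs, abs_of_nonneg (by linarith), mul_one]
            have : d = 1 - r := by
              rw [hd, ← h, show r • ξ - ξ = (r - 1) • ξ by rw [sub_smul, one_smul], norm_smul, hξ, Real.norm_eq_abs, abs_of_nonpos (by linarith)]; ring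
            linarith
          rw [hG, Set.indicator_of_mem h5, ← ENNReal.ofReal_mul (by positivity)]
          apply ENNReal.ofReal_le_ofReal
          have h7 : (1/8 : ℝ) ≤ r^3 := by
            have : (1/2:ℝ)^3 ≤ r^3 := by gcongr
            linarith
          have h8 : ((5/4)*d)^(-(s+1)) ≤ ‖r • ξ - y‖^(-(s+1)) := Real.rpow_le_rpow_of_nonpos h6 h4 (by linarith)
          have : 0 ≤ ((5/4)*d)^(-(s+1)) := by positivity
          exact mul_le_mul h7 h8 this (by positivity)
      _ ≤ _ := lintegral_mono_set hsub
  have h1 : ∫⁻ ξ, ENNReal.ofReal (c * ‖y - ξ‖^(-s)) ∂(sphMeasure 4) ≤ ENNReal.ofReal V := by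
    rw [← hGV, hsw]
    apply lintegral_mono_ae
    filter_upwards [sph_ae] with ξ hξ using hlow ξ hξ
  have h2 : ∫⁻ ξ, ENNReal.ofReal (‖y - ξ‖^(-s)) ∂(sphMeasure 4) = ENNReal.ofReal c⁻¹ * ∫⁻ ξ, ENNReal.ofReal (c * ‖y - ξ‖^(-s)) ∂(sphMeasure 4) := by
    rw [← lintegral_const_mul _ (by fun_prop)]
    congr 1; ext ξ
    rw [← ENNReal.ofReal_mul (by positivity), inv_mul_cancel_left₀ hc0.ne']
  rw [h2, ENNReal.ofReal_mul (by positivity)]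
  gcongr

lemma N_int {ξ : E 4} (hξ : ‖ξ‖ = 1) {s : ℝ} (hs : s < 4) (L : E 4 → ℝ) (hL : Continuous L) :
    IntegrableOn (fun x => ‖x - ξ‖^(-s) * L x ^ 2) (ball 0 1) := by
  have r := rad_int ξ (a := s) (R := 2) (by linarith) (by norm_num)
  have hs : ball (0 : E 4) 1 ⊆ ball ξ 2 := by
    apply ball_subset_ball'; simp [hξ]; norm_num
  obtain ⟨M, hM⟩ := (isCompact_closedBall (0 : E 4) 1).exists_bound_of_continuousOn (hL.pow 2).continuousOn
  refine Integrable.mul_bdd (c := M) (r.1.mono_set hs) (hL.pow 2).aestronglyMeasurable ?_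
  filter_upwards [ae_restrict_mem measurableSet_ball] with x hx
  exact hM x (ball_subset_closedBall hx)

set_option maxHeartbeats 1000000 in
lemma hedberg {ξ : E 4} (hξ : ‖ξ‖ = 1) {s ρ δ : ℝ} (hs0 : 0 < s) (hs : s < 3) (hρ : 0 < ρ) (hδ : ρ ≤ δ) (L : E 4 → ℝ) (hL : Continuous L) :
    ∫ x in ball 0 1, ‖x - ξ‖^(-2:ℝ) * |L x| ≤
      √(2 * Real.pi^2 * (ρ^s / s)) * √(∫ x in ball 0 1, ‖x - ξ‖^(-s) * L x ^ 2)
      + √(Real.pi^2 * Real.log (δ/ρ)) * √(∫ x in ball 0 1 ∩ ball ξ δ, L x ^ 2)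
      + √(δ^(-4:ℝ) * (Real.pi^2/2)) * √(∫ x in ball 0 1, L x ^ 2) := by
  have hδ0 : 0 < δ := hρ.trans_le hδ
  have hI := (I_lim hξ L hL).1
  have hN := N_int hξ (by linarith : s < 4) L hL
  have hL2 : IntegrableOn (fun x => L x ^ 2) (ball 0 1) := ball_int (hL.pow 2)
  have hpos : ∀ x ∈ ball (0 : E 4) 1, 0 < ‖x - ξ‖ := by
    intro x hx
    simpa using tyx_pos (t := 1) hξ (by norm_num) (by simpa using hx)
  have mk : ∀ a : ℝ, Measurable (fun x : E 4 => ‖x - ξ‖^a) := by intro a; fun_prop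
  have mL : Measurable L := hL.measurable
  have dec : ∫ x in ball 0 1, ‖x - ξ‖^(-2:ℝ) * |L x| =
      (∫ x in ball 0 1 ∩ ball ξ ρ, ‖x - ξ‖^(-2:ℝ) * |L x|) + (∫ x in ball 0 1 ∩ (ball ξ δ \ ball ξ ρ), ‖x - ξ‖^(-2:ℝ) * |L x|)
      + ∫ x in ball 0 1 \ ball ξ δ, ‖x - ξ‖^(-2:ℝ) * |L x| := by
    rw [← integral_inter_add_sdiff (s := ball 0 1) (t := ball ξ δ) measurableSet_ball hI]
    congr 1
    rw [← integral_inter_add_sdiff (s := ball 0 1 ∩ ball ξ δ) (t := ball ξ ρ) measurableSet_ball (hI.mono_set Set.inter_subset_left)]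
    congr 2
    · rw [Set.inter_assoc, Set.inter_eq_right.2 (ball_subset_ball hδ)]
    · rw [Set.inter_sdiff_assoc]
  rw [dec]
  have conv4 : ∀ x ∈ ball (0 : E 4) 1, (‖x - ξ‖^(-2:ℝ))^2 = ‖x - ξ‖^(-4:ℝ) := by
    intro x hx
    rw [← Real.rpow_natCast, ← Real.rpow_mul (norm_nonneg _)]; norm_num
  refine add_le_add (add_le_add ?_ ?_) ?_
  · have ms : MeasurableSet (ball (0 : E 4) 1 ∩ ball ξ ρ) := measurableSet_ball.inter measurableSet_ball
    have r := rad_int ξ (a := 4 - s) (R := ρ) (by linarith) hρ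
    have e1 : ∀ x ∈ ball (0 : E 4) 1 ∩ ball ξ ρ, ‖x - ξ‖^(-2:ℝ) * |L x| = ‖x - ξ‖^(-2 + s/2) * (‖x - ξ‖^(-s/2) * |L x|) := by
      intro x hx
      rw [← mul_assoc, ← Real.rpow_add (hpos x hx.1)]
      ring_nf
    have e2 : ∀ x : E 4, (‖x - ξ‖^(-2 + s/2))^2 = ‖x - ξ‖^(-(4-s)) := by
      intro x
      rw [← Real.rpow_natCast, ← Real.rpow_mul (norm_nonneg _)]
      congr 1; push_cast; ring
    have e3 : ∀ x : E 4, (‖x - ξ‖^(-s/2) * |L x|)^2 = ‖x - ξ‖^(-s) * L x ^ 2 := by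
      intro x
      rw [mul_pow, sq_abs, ← Real.rpow_natCast, ← Real.rpow_mul (norm_nonneg _)]
      congr 2; push_cast; ring
    rw [setIntegral_congr_fun ms e1]
    have := CS (volume.restrict (ball (0 : E 4) 1 ∩ ball ξ ρ)) (fun x => ‖x - ξ‖^(-2 + s/2)) (fun x => ‖x - ξ‖^(-s/2) * |L x|)
      (Eventually.of_forall fun x => by positivity) (Eventually.of_forall fun x => by positivity)
      (mk _).aestronglyMeasurable ((mk _).mul hL.abs.measurable).aestronglyMeasurable
      (by simp_rw [e2]; exact r.1.mono_set Set.inter_subset_right)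
      (by simp_rw [e3]; exact hN.mono_set Set.inter_subset_left)
    refine this.trans ?_
    simp_rw [e2, e3]
    refine mul_le_mul ?_ ?_ (Real.sqrt_nonneg _) (Real.sqrt_nonneg _)
    · apply Real.sqrt_le_sqrt
      have h2 := r.2
      rw [show 4 - (4 - s) = s by ring] at h2
      rw [← h2]
      exact setIntegral_mono_set r.1 (Eventually.of_forall fun x => by simp only [Pi.zero_apply]; positivity) (LE.le.eventuallyLE Set.inter_subset_right)
    · apply Real.sqrt_le_sqrt
      exact setIntegral_mono_set hN (Eventually.of_forall fun x => by simp only [Pi.zero_apply]; positivity) (LE.le.eventuallyLE Set.inter_subset_left)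
  · have an := annulus hρ hδ hξ
    have ms : MeasurableSet (ball (0 : E 4) 1 ∩ (ball ξ δ \ ball ξ ρ)) := measurableSet_ball.inter (measurableSet_ball.diff measurableSet_ball)
    have e4 := setIntegral_congr_fun (μ := volume) ms (fun x hx => conv4 x hx.1)
    have := CS (volume.restrict (ball (0 : E 4) 1 ∩ (ball ξ δ \ ball ξ ρ))) (fun x => ‖x - ξ‖^(-2:ℝ)) (fun x => |L x|)
      (Eventually.of_forall fun x => by positivity) (Eventually.of_forall fun x => by positivity)
      (mk _).aestronglyMeasurable hL.abs.aestronglyMeasurable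
      (an.1.congr_fun (fun x hx => (conv4 x hx.1).symm) ms)
      (by simp_rw [sq_abs]; exact hL2.mono_set Set.inter_subset_left)
    refine this.trans ?_
    simp_rw [sq_abs]
    rw [e4]
    refine mul_le_mul ?_ ?_ (Real.sqrt_nonneg _) (Real.sqrt_nonneg _)
    · exact Real.sqrt_le_sqrt an.2
    · apply Real.sqrt_le_sqrt
      exact setIntegral_mono_set (hL2.mono_set Set.inter_subset_left) (Eventually.of_forall fun x => by simp only [Pi.zero_apply]; positivity)
        (LE.le.eventuallyLE (Set.inter_subset_inter_right _ Set.sdiff_subset))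
  · have ms : MeasurableSet (ball (0 : E 4) 1 \ ball ξ δ) := measurableSet_ball.diff measurableSet_ball
    have hb : ∀ x ∈ ball (0 : E 4) 1 \ ball ξ δ, (‖x - ξ‖^(-2:ℝ))^2 ≤ δ^(-4:ℝ) := by
      intro x hx
      have h1 : δ ≤ ‖x - ξ‖ := by simpa [dist_eq_norm] using hx.2
      rw [conv4 x hx.1]
      exact Real.rpow_le_rpow_of_nonpos hδ0 h1 (by norm_num)
    have hfin : volume (ball (0 : E 4) 1 \ ball ξ δ) ≠ ⊤ := (lt_of_le_of_lt (measure_mono Set.sdiff_subset) measure_ball_lt_top).ne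
    have i1 : IntegrableOn (fun x => (‖x - ξ‖^(-2:ℝ))^2) (ball (0 : E 4) 1 \ ball ξ δ) := by
      refine Measure.integrableOn_of_bounded (M := δ^(-4:ℝ)) hfin ((mk _).pow_const 2).aestronglyMeasurable ?_
      filter_upwards [ae_restrict_mem ms] with x hx
      rw [Real.norm_of_nonneg (by positivity)]
      exact hb x hx
    have := CS (volume.restrict (ball (0 : E 4) 1 \ ball ξ δ)) (fun x => ‖x - ξ‖^(-2:ℝ)) (fun x => |L x|)
      (Eventually.of_forall fun x => by positivity) (Eventually.of_forall fun x => by positivity)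
      (mk _).aestronglyMeasurable hL.abs.aestronglyMeasurable i1
      (by simp_rw [sq_abs]; exact hL2.mono_set Set.sdiff_subset)
    refine this.trans ?_
    simp_rw [sq_abs]
    refine mul_le_mul ?_ ?_ (Real.sqrt_nonneg _) (Real.sqrt_nonneg _)
    · apply Real.sqrt_le_sqrt
      have h1 := setIntegral_mono_on i1 (integrableOn_const (C := δ^(-4:ℝ)) hfin) ms hb
      refine h1.trans ?_
      rw [setIntegral_const, smul_eq_mul, mul_comm, ← vol_ball4]
      gcongr
      · exact measure_ball_lt_top.ne
      · exact Set.sdiff_subset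
    · apply Real.sqrt_le_sqrt
      exact setIntegral_mono_set hL2 (Eventually.of_forall fun x => by simp only [Pi.zero_apply]; positivity)
        (LE.le.eventuallyLE Set.sdiff_subset)

lemma pointwise_bound {p m δ Λ s : ℝ} (hp : 0 < p) (hm : 0 < m) (hδ : 0 < δ) (hs0 : 0 < s) (hs : s < 3)
    {ε : ℝ} (hε : 0 < ε) (hcond : 3 * (p * m) * (1 + ε) ≤ s) :
    ∃ C : ℝ, ∀ u : E 4 → ℝ, ContDiff ℝ 2 u → (∀ x ∈ sphere 0 1, fderiv ℝ u x x = 0) → Continuous (lap 4 u) →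
      ∫ y, u y ∂(sphMeasure 4) = 0 → ∫ x in ball 0 1, lap 4 u x ^ 2 ≤ Λ → ∀ ξ : E 4, ‖ξ‖ = 1 →
      ∫ x in ball 0 1 ∩ ball ξ δ, lap 4 u x ^ 2 ≤ m →
      Real.exp (12 * Real.pi^2 * p * u ξ ^ 2) ≤ Real.exp C * (1 + ∫ x in ball 0 1, ‖x - ξ‖^(-s) * lap 4 u x ^ 2) := by
  set C1 := √(2 * Real.pi^2 * (δ^s / s)) + √(δ^(-4:ℝ) * (Real.pi^2/2)) * √Λ + 6 * √(32 * Real.pi^2) * √Λ with hC1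
  refine ⟨3 * p / Real.pi^2 * ((1 + 1/ε) * C1^2), ?_⟩
  intro u hu hneu hL hmean hu2 ξ hξ hum
  set N := ∫ x in ball 0 1, ‖x - ξ‖^(-s) * lap 4 u x ^ 2 with hN
  have hN0 : 0 ≤ N := setIntegral_nonneg measurableSet_ball (fun x _ => mul_nonneg (Real.rpow_nonneg (norm_nonneg _) _) (sq_nonneg _))
  clear_value N
  set ρ := δ * (1 + N)^(-(1/s)) with hρ
  have h1N : 0 < 1 + N := by linarith
  have hρ0 : 0 < ρ := mul_pos hδ (Real.rpow_pos_of_pos h1N _)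
  have hρδ : ρ ≤ δ := by
    have : (1 + N)^(-(1/s)) ≤ 1 := Real.rpow_le_one_of_one_le_of_nonpos (by linarith) (by
      have : 0 < 1/s := by positivity
      linarith)
    rw [hρ]; nlinarith
  have hρs : ρ^s = δ^s * (1+N)⁻¹ := by
    rw [hρ, Real.mul_rpow hδ.le (by positivity), ← Real.rpow_mul h1N.le, show -(1/s) * s = -1 by field_simp, Real.rpow_neg_one]
  have hlog : Real.log (δ/ρ) = Real.log (1 + N) / s := by
    rw [Real.log_div hδ.ne' hρ0.ne', hρ, Real.log_mul hδ.ne' (by positivity), Real.log_rpow h1N]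
    ring
  have hlog0 : 0 ≤ Real.log (1 + N) := Real.log_nonneg (by linarith)
  have hr := repr_bound hξ u hu hneu hL hmean
  have hh := hedberg hξ hs0 hs hρ0 hρδ (lap 4 u) hL
  rw [← hN, hlog] at hh
  have t1 : √(2 * Real.pi^2 * (ρ^s / s)) * √N ≤ √(2 * Real.pi^2 * (δ^s / s)) := by
    rw [← Real.sqrt_mul (by positivity)]
    apply Real.sqrt_le_sqrt
    rw [hρs]
    have : (1 + N)⁻¹ * N ≤ 1 := by rw [inv_mul_le_iff₀ h1N]; linarith
    calc 2 * Real.pi^2 * (δ^s * (1+N)⁻¹ / s) * N = 2 * Real.pi^2 * (δ^s / s) * ((1 + N)⁻¹ * N) := by ring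
      _ ≤ 2 * Real.pi^2 * (δ^s / s) * 1 := by gcongr
      _ = _ := by ring
  set b := √(Real.pi^2 * (Real.log (1 + N) / s)) * √m with hb
  have t2 : √(Real.pi^2 * (Real.log (1 + N) / s)) * √(∫ x in ball 0 1 ∩ ball ξ δ, lap 4 u x ^ 2) ≤ b :=
    mul_le_mul_of_nonneg_left (Real.sqrt_le_sqrt hum) (Real.sqrt_nonneg _)
  have t3 : √(δ^(-4:ℝ) * (Real.pi^2/2)) * √(∫ x in ball 0 1, lap 4 u x ^ 2) ≤ √(δ^(-4:ℝ) * (Real.pi^2/2)) * √Λ :=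
    mul_le_mul_of_nonneg_left (Real.sqrt_le_sqrt hu2) (Real.sqrt_nonneg _)
  have t4 : 6 * √(32 * Real.pi^2) * √(∫ x in ball 0 1, lap 4 u x ^ 2) ≤ 6 * √(32 * Real.pi^2) * √Λ :=
    mul_le_mul_of_nonneg_left (Real.sqrt_le_sqrt hu2) (by positivity)
  have hmain : 2 * Real.pi^2 * |u ξ| ≤ C1 + b := by linarith
  have hb2 : b^2 = Real.pi^2 * (Real.log (1 + N) / s) * m := by
    rw [hb, mul_pow, Real.sq_sqrt (by positivity), Real.sq_sqrt hm.le]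
  have hsq : (2 * Real.pi^2 * |u ξ|)^2 ≤ (1 + 1/ε) * C1^2 + (1 + ε) * b^2 := by
    have a1 : (2 * Real.pi^2 * |u ξ|)^2 ≤ (C1 + b)^2 := by gcongr
    have a2 : (C1 + b)^2 ≤ (1 + 1/ε) * C1^2 + (1 + ε) * b^2 := by
      have a3 : (1 + 1/ε) * C1^2 + (1 + ε) * b^2 - (C1 + b)^2 = (C1 - ε * b)^2 / ε := by field_simp; ring
      have : 0 ≤ (C1 - ε * b)^2 / ε := by positivity
      linarith
    linarith
  have hexp : 12 * Real.pi^2 * p * u ξ ^ 2 ≤ 3 * p / Real.pi^2 * ((1 + 1/ε) * C1^2) + Real.log (1 + N) := by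
    have a1 : 12 * Real.pi^2 * p * u ξ ^ 2 = 3 * p / Real.pi^2 * (2 * Real.pi^2 * |u ξ|)^2 := by
      rw [mul_pow, sq_abs]; field_simp; ring
    rw [a1]
    have a2 := mul_le_mul_of_nonneg_left hsq (by positivity : 0 ≤ 3 * p / Real.pi^2)
    refine a2.trans ?_
    rw [mul_add]
    gcongr
    rw [hb2]
    have a3 : 3 * p / Real.pi^2 * ((1 + ε) * (Real.pi^2 * (Real.log (1 + N) / s) * m)) = (3 * (p * m) * (1 + ε)) / s * Real.log (1 + N) := by
      field_simp
    rw [a3]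
    have a4 : (3 * (p * m) * (1 + ε)) / s ≤ 1 := by rw [div_le_one hs0]; exact hcond
    nlinarith
  calc _ ≤ _ := Real.exp_le_exp.2 hexp
    _ = _ := by rw [Real.exp_add, Real.exp_log h1N]

lemma final_bound {p m δ Λ : ℝ} (hp : 0 < p) (hm : 0 < m) (hpm : p * m < 1) (hδ : 0 < δ) (hΛ : 0 ≤ Λ)
    (K : Set (E 4)) (hK : MeasurableSet K) :
    ∃ C : ℝ, ∀ u : E 4 → ℝ, ContDiff ℝ 2 u → (∀ x ∈ sphere 0 1, fderiv ℝ u x x = 0) → Continuous (lap 4 u) →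
      ∫ y, u y ∂(sphMeasure 4) = 0 → ∫ x in ball 0 1, lap 4 u x ^ 2 ≤ Λ →
      (∀ ξ ∈ K, ∫ x in ball 0 1 ∩ ball ξ δ, lap 4 u x ^ 2 ≤ m) →
      ∫ ξ in K, Real.exp (12 * Real.pi^2 * p * u ξ ^ 2) ∂(sphMeasure 4) ≤ C := by
  set θ := p * m with hθ
  have hθ0 : 0 < θ := by positivity
  set s := 3 * (1 + θ) / 2 with hs
  have hs0 : 0 < s := by positivity
  have hs3 : s < 3 := by rw [hs]; linarith
  obtain ⟨C, hC⟩ := pointwise_bound (ε := (1 - θ)/(2*θ)) hp hm hδ hs0 hs3 (by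
    apply div_pos <;> linarith) (by
    rw [← hθ, hs]; apply le_of_eq; field_simp; ring)
  obtain ⟨D, hD0, hD⟩ := sph_kernel hs0 hs3
  refine ⟨Real.exp C * (2 * Real.pi^2 + D * Λ), ?_⟩
  intro u hu hneu hL hmean hu2 hum
  rw [integral_eq_lintegral_of_nonneg_ae (Eventually.of_forall fun x => (Real.exp_pos _).le) (by
    have := hu.continuous.measurable
    apply Measurable.aestronglyMeasurable
    fun_prop)]
  apply ENNReal.toReal_le_of_le_ofReal (by positivity)
  have hk : Measurable (fun q : E 4 × E 4 => ENNReal.ofReal (‖q.2 - q.1‖^(-s) * lap 4 u q.2 ^ 2)) := by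
    have : Measurable (fun q : E 4 × E 4 => lap 4 u q.2) := hL.measurable.comp measurable_snd
    fun_prop
  have hstep : ∫⁻ ξ in K, ENNReal.ofReal (Real.exp (12 * Real.pi^2 * p * u ξ ^ 2)) ∂(sphMeasure 4) ≤
      ∫⁻ ξ, ENNReal.ofReal (Real.exp C) * (1 + ∫⁻ x in ball 0 1, ENNReal.ofReal (‖x - ξ‖^(-s) * lap 4 u x ^ 2)) ∂(sphMeasure 4) := by
    refine le_trans ?_ (setLIntegral_le_lintegral K _)
    apply lintegral_mono_ae
    filter_upwards [ae_restrict_mem hK, ae_restrict_of_ae sph_ae] with ξ hξK hξ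
    have h1 := hC u hu hneu hL hmean hu2 ξ hξ (hum ξ hξK)
    refine (ENNReal.ofReal_le_ofReal h1).trans ?_
    have h0 : 0 ≤ ∫ x in ball 0 1, ‖x - ξ‖^(-s) * lap 4 u x ^ 2 := setIntegral_nonneg measurableSet_ball (fun x _ => by positivity)
    rw [ENNReal.ofReal_mul (Real.exp_pos _).le, ENNReal.ofReal_add zero_le_one h0, ENNReal.ofReal_one,
      ofReal_integral_eq_lintegral_ofReal (N_int hξ (by linarith) _ hL) (Eventually.of_forall fun z => by simp only [Pi.zero_apply]; positivity)]
  refine hstep.trans ?_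
  have hkm : Measurable (fun ξ : E 4 => ∫⁻ x in ball 0 1, ENNReal.ofReal (‖x - ξ‖^(-s) * lap 4 u x ^ 2)) :=
    hk.lintegral_prod_right'
  rw [lintegral_const_mul _ (by fun_prop), ENNReal.ofReal_mul (Real.exp_pos _).le]
  gcongr
  rw [lintegral_add_left measurable_const, lintegral_const, one_mul, ENNReal.ofReal_add (by positivity) (by positivity), ← sph_univ]
  have hu1 : (sphMeasure 4) Set.univ = ENNReal.ofReal ((sphMeasure 4).real Set.univ) := by
    rw [Measure.real, ENNReal.ofReal_toReal (measure_ne_top _ _)]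
  rw [← hu1]
  gcongr
  rw [lintegral_lintegral_swap hk.aemeasurable]
  calc ∫⁻ x in ball 0 1, (∫⁻ ξ, ENNReal.ofReal (‖x - ξ‖^(-s) * lap 4 u x ^ 2) ∂(sphMeasure 4))
      ≤ ∫⁻ x in ball 0 1, ENNReal.ofReal D * ENNReal.ofReal (lap 4 u x ^ 2) := by
        apply setLIntegral_mono' measurableSet_ball
        intro x hx
        have h1 : ∀ ξ : E 4, ENNReal.ofReal (‖x - ξ‖^(-s) * lap 4 u x ^ 2) = ENNReal.ofReal (‖x - ξ‖^(-s)) * ENNReal.ofReal (lap 4 u x ^ 2) :=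
          fun ξ => ENNReal.ofReal_mul (by positivity)
        simp_rw [h1]
        rw [lintegral_mul_const _ (by fun_prop)]
        gcongr
        exact hD x (by simpa using hx)
    _ = ENNReal.ofReal D * ENNReal.ofReal (∫ x in ball 0 1, lap 4 u x ^ 2) := by
        rw [lintegral_const_mul _ (by have := hL.measurable; fun_prop)]
        rw [ofReal_integral_eq_lintegral_ofReal (f := fun x => lap 4 u x ^ 2) (ball_int (hL.pow 2)) (Eventually.of_forall fun z => by simp only [Pi.zero_apply]; positivity)]
    _ ≤ _ := by
        rw [ENNReal.ofReal_mul hD0]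
        gcongr

lemma cd2 {u : E 4 → ℝ} (hu : ContDiff ℝ (⊤ : ℕ∞) u) : ContDiff ℝ 2 u :=
  contDiff_infty.1 hu 2

lemma lap_cont {u : E 4 → ℝ} (hu : ContDiff ℝ (⊤ : ℕ∞) u) : Continuous (lap 4 u) := by
  have h2 : ContDiff ℝ 2 u := cd2 hu
  unfold lap
  apply continuous_finsetSum
  intro i _
  have h3 : ContDiff ℝ 1 (fun y => fderiv ℝ u y (EuclideanSpace.single i 1)) :=
    (h2.fderiv_right (m := 1) (by norm_num)).clm_apply contDiff_const
  exact (h3.continuous_fderiv (by norm_num)).clm_apply continuous_const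

theorem stmt11 (f : ℕ → E 4 → ℝ) (u : ℕ → E 4 → ℝ) (u₀ : E 4 → ℝ)
    (hf : ∀ i, ContDiff ℝ (⊤ : ℕ∞) (f i)) (hu : ∀ i, ContDiff ℝ (⊤ : ℕ∞) (u i)) (hu₀ : ContDiff ℝ (⊤ : ℕ∞) u₀)
    -- the `f_i` have mean zero on `S³`
    (hmean : ∀ i, ∫ x, f i x ∂(sphMeasure 4) = 0)
    -- `u_i` is the biharmonic extension of `f_i` with zero Neumann boundary condition
    (hbih : ∀ i, ∀ x ∈ Metric.ball (0 : E 4) 1, lap 4 (lap 4 (u i)) x = 0)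
    (hbd' : ∀ i, ∀ x ∈ Metric.sphere (0 : E 4) 1, u i x = f i x)
    (hneu : ∀ i, ∀ x ∈ Metric.sphere (0 : E 4) 1, fderiv ℝ (u i) x x = 0)
    -- `u_i ⇀ u₀` weakly in `H²(𝔹⁴)` : boundedness plus weak convergence against tests
    (hbdd : ∃ C : ℝ, ∀ i, (∫ x in Metric.ball (0 : E 4) 1,
      ((u i x) ^ 2 + ‖fderiv ℝ (u i) x‖ ^ 2 + ‖iteratedFDeriv ℝ 2 (u i) x‖ ^ 2)) ≤ C)
    (hweak : ∀ v : E 4 → ℝ, ContDiff ℝ (⊤ : ℕ∞) v →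
      Tendsto (fun i => ∫ x in Metric.ball (0 : E 4) 1, u i x * v x) atTop
        (nhds (∫ x in Metric.ball (0 : E 4) 1, u₀ x * v x)))
    -- `u_i → u₀` almost everywhere in `𝔹⁴`
    (hae : ∀ᵐ x ∂(volume.restrict (Metric.ball (0 : E 4) 1)),
      Tendsto (fun i => u i x) atTop (nhds (u₀ x)))
    (σ : Measure (E 4)) [IsFiniteMeasure σ]
    -- `(Δu_i)² dx ⇀ (Δu₀)² dx + σ` as measures on `𝔹⁴`
    (hσ : ∀ φ : E 4 → ℝ, Continuous φ →
      Tendsto (fun i => ∫ x in Metric.ball (0 : E 4) 1, (lap 4 (u i) x) ^ 2 * φ x) atTop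
        (nhds ((∫ x in Metric.ball (0 : E 4) 1, (lap 4 u₀ x) ^ 2 * φ x) + ∫ x, φ x ∂σ)))
    (K : Set (E 4)) (hK : IsCompact K) (hKs : K ⊆ Metric.sphere (0 : E 4) 1)
    (hσK : σ (cone 4 K) < 1)
    (p : ℝ) (hp1 : 1 ≤ p) (hp2 : ENNReal.ofReal p * σ (cone 4 K) < 1) :
    ∃ C : ℝ, ∀ i,
      (∫ x in K, Real.exp (12 * Real.pi ^ 2 * p * (f i x) ^ 2) ∂(sphMeasure 4)) ≤ C := by
  rcases K.eq_empty_or_nonempty with rfl | hKne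
  · exact ⟨0, fun i => by simp⟩
  have hKm : MeasurableSet K := hK.measurableSet
  have hp0 : 0 < p := by linarith
  have hLc : ∀ i, Continuous (lap 4 (u i)) := fun i => lap_cont (hu i)
  have hL0 : Continuous (lap 4 u₀) := lap_cont hu₀
  have hKσ : σ K ≤ σ (cone 4 K) := measure_mono fun x hx => ⟨1, zero_le_one, le_rfl, x, hx, by simp⟩
  have hpK : p * σ.real K < 1 := by
    have h1 : ENNReal.ofReal p * σ K < 1 := lt_of_le_of_lt (by gcongr) hp2
    have h2 := (ENNReal.toReal_lt_toReal h1.ne_top ENNReal.one_ne_top).2 h1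
    rwa [ENNReal.toReal_mul, ENNReal.toReal_ofReal hp0.le, ENNReal.toReal_one] at h2
  obtain ⟨m, hm1, hm2⟩ := exists_between (show σ.real K < 1 / p by rw [lt_div_iff₀ hp0]; linarith)
  have hm0 : 0 < m := lt_of_le_of_lt measureReal_nonneg hm1
  have hpm : p * m < 1 := by rw [lt_div_iff₀ hp0] at hm2; linarith
  set φ : ℕ → E 4 → ℝ := fun n x => min 1 (max 0 (2 - (n + 1 : ℝ) * infDist x K)) with hφ
  have hφc : ∀ n, Continuous (φ n) := by
    intro n
    have := continuous_infDist_pt K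
    simp only [hφ]
    fun_prop
  have hφ0 : ∀ n x, 0 ≤ φ n x := fun n x => le_min zero_le_one (le_max_left _ _)
  have hφ1 : ∀ n x, φ n x ≤ 1 := fun n x => min_le_left _ _
  have hφK : ∀ n : ℕ, ∀ x : E 4, infDist x K ≤ 1 / (n + 1 : ℝ) → φ n x = 1 := by
    intro n x hx
    rw [le_div_iff₀ (by positivity)] at hx
    simp only [hφ]
    apply min_eq_left
    apply le_max_of_le_right
    linarith
  have hφl : ∀ x, Tendsto (fun n => φ n x) atTop (nhds (K.indicator (fun _ => (1:ℝ)) x)) := by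
    intro x
    by_cases hx : x ∈ K
    · rw [Set.indicator_of_mem hx]
      apply tendsto_const_nhds.congr
      intro n
      rw [hφK n x]
      rw [infDist_zero_of_mem hx]; positivity
    · rw [Set.indicator_of_notMem hx]
      have hd : 0 < infDist x K := (hK.isClosed.notMem_iff_infDist_pos hKne).1 hx
      obtain ⟨n0, hn0⟩ := exists_nat_gt (2 / infDist x K)
      rw [div_lt_iff₀ hd] at hn0
      apply tendsto_const_nhds.congr'
      filter_upwards [eventually_ge_atTop n0] with n hn
      have : (n0 : ℝ) ≤ n := by exact_mod_cast hn
      simp only [hφ]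
      rw [max_eq_left (by nlinarith), min_eq_right zero_le_one]
  have lim1 : Tendsto (fun n => ∫ x, φ n x ∂σ) atTop (nhds (σ.real K)) := by
    have : Tendsto (fun n => ∫ x, φ n x ∂σ) atTop (nhds (∫ x, K.indicator (fun _ => (1:ℝ)) x ∂σ)) := by
      apply tendsto_integral_of_dominated_convergence (fun _ => (1:ℝ))
      · exact fun n => (hφc n).aestronglyMeasurable
      · exact integrable_const _
      · exact fun n => Eventually.of_forall fun x => by rw [Real.norm_of_nonneg (hφ0 n x)]; exact hφ1 n x
      · exact Eventually.of_forall hφl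
    rw [integral_indicator hKm] at this
    simpa using this
  have lim2 : Tendsto (fun n => ∫ x in ball (0 : E 4) 1, (lap 4 u₀ x)^2 * φ n x) atTop (nhds 0) := by
    have : Tendsto (fun n => ∫ x in ball (0 : E 4) 1, (lap 4 u₀ x)^2 * φ n x) atTop (nhds (∫ x in ball (0 : E 4) 1, (0:ℝ))) := by
      apply tendsto_integral_of_dominated_convergence (fun x => (lap 4 u₀ x)^2)
      · exact fun n => ((hL0.pow 2).mul (hφc n)).aestronglyMeasurable
      · exact ball_int (hL0.pow 2)
      · refine fun n => Eventually.of_forall fun x => ?_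
        rw [Real.norm_of_nonneg (mul_nonneg (sq_nonneg _) (hφ0 n x))]
        exact mul_le_of_le_one_right (sq_nonneg _) (hφ1 n x)
      · filter_upwards [ae_restrict_mem measurableSet_ball] with x hx
        have hxK : x ∉ K := by
          intro h
          have h1 := hKs h
          simp only [mem_sphere, mem_ball] at h1 hx
          linarith
        have h2 := hφl x
        rw [Set.indicator_of_notMem hxK] at h2
        simpa using h2.const_mul ((lap 4 u₀ x)^2)
    simpa using this
  have lim3 := lim2.add lim1
  rw [zero_add] at lim3
  obtain ⟨n, hn⟩ := (lim3.eventually_lt_const hm1).exists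
  have ev1 := (hσ (φ n) (hφc n)).eventually_lt_const hn
  set Λ := ((∫ x in ball (0 : E 4) 1, (lap 4 u₀ x) ^ 2 * (1:ℝ)) + ∫ x, (1:ℝ) ∂σ) + 1 with hΛ
  have hΛ0 : 0 ≤ Λ := by
    have h1 : 0 ≤ ∫ x in ball (0 : E 4) 1, (lap 4 u₀ x) ^ 2 * (1:ℝ) := setIntegral_nonneg measurableSet_ball (fun x _ => by positivity)
    have h2 : 0 ≤ ∫ x, (1:ℝ) ∂σ := integral_nonneg (fun x => zero_le_one)
    linarith
  have ev2 := (hσ (fun _ => 1) continuous_const).eventually_lt_const (lt_add_one _)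
  obtain ⟨C, hC⟩ := final_bound (δ := 1 / (n + 1 : ℝ)) hp0 hm0 hpm (by positivity) hΛ0 K hKm
  have ev3 : ∀ᶠ i in atTop, (∫ x in K, Real.exp (12 * Real.pi ^ 2 * p * (f i x) ^ 2) ∂(sphMeasure 4)) ≤ C := by
    filter_upwards [ev1, ev2] with i h1 h2
    have e1 : ∫ x in K, Real.exp (12 * Real.pi ^ 2 * p * (f i x) ^ 2) ∂(sphMeasure 4) = ∫ x in K, Real.exp (12 * Real.pi ^ 2 * p * (u i x) ^ 2) ∂(sphMeasure 4) := by
      apply setIntegral_congr_fun hKm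
      intro x hx
      simp only [hbd' i x (hKs hx)]
    rw [e1]
    apply hC (u i) (cd2 (hu i)) (hneu i) (hLc i)
    · rw [← hmean i]
      apply integral_congr_ae
      filter_upwards [sph_ae] with y hy
      exact hbd' i y (by simpa using hy)
    · simp only [mul_one] at h2 hΛ
      rw [hΛ]; exact h2.le
    · intro ξ hξ
      refine le_trans ?_ h1.le
      have i1 : IntegrableOn (fun x => lap 4 (u i) x ^ 2 * φ n x) (ball 0 1) := ball_int (((hLc i).pow 2).mul (hφc n))
      refine le_trans (le_of_eq ?_) (setIntegral_mono_set (s := ball 0 1 ∩ ball ξ (1 / (n + 1 : ℝ))) i1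
        (Eventually.of_forall fun x => mul_nonneg (sq_nonneg _) (hφ0 n x)) (LE.le.eventuallyLE Set.inter_subset_left))
      apply setIntegral_congr_fun (measurableSet_ball.inter measurableSet_ball)
      intro x hx
      have h3 : infDist x K ≤ 1 / (n + 1 : ℝ) := (infDist_le_dist_of_mem hξ).trans (le_of_lt hx.2)
      simp only [hφK n x h3, mul_one]
  obtain ⟨B, hB⟩ := (IsBoundedUnder.bddAbove_range (f := fun i => ∫ x in K, Real.exp (12 * Real.pi ^ 2 * p * (f i x) ^ 2) ∂(sphMeasure 4)) ⟨C, by simpa using ev3⟩)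
  exact ⟨B, fun i => hB ⟨i, rfl⟩⟩
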